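/- arXiv:2408.05887 — 2 statements merged into one kernel-verified Lean document; each statement's English description precedes it below -/
import Mathlib

section
/- Let K ≥ 2, let Σ be a K×K real positive definite matrix, let λ = 1_K^T Σ^{-1} 1_K, let α ∈ (0,1) and μ₀ ∈ ℝ. For z ∈ ℝ^K define m(z) = 1_K^T Σ^{-1} z / λ and S(z)² = (1/(λ(K−1)))·(z − m(z)1_K)^T Σ^{-1} (z − m(z)1_K), and define the rejection region R = { z ∈ ℝ^K : |m(z − μ₀1_K)| > t_{K−1,1−α/2}·S(z) }. Then: (i) for every σ > 0, N(μ₀1_K, σ²Σ)(R) = α; and (ii) for every measurable test φ : ℝ^K → [0,1] that is unbiased at level α for H₀: μ = μ₀ in the family {N(μ1_K, σ²Σ) : μ ∈ ℝ, σ² > 0} (i.e., ∫φ dN(μ₀1_K, σ²Σ) ≤ α for all σ > 0 and ∫φ dN(μ1_K, σ²Σ) ≥ α for all μ ≠ μ₀ and σ > 0), one has ∫φ dN(μ1_K, σ²Σ) ≤ N(μ1_K, σ²Σ)(R) for every μ ∈ ℝ and σ > 0. In other words, the indicator test of R is uniformly most powerful unbiased at level α. -/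
open MeasureTheory ProbabilityTheory Matrix Filter Topology

noncomputable section

/-- The standard Gaussian measure on `Fin K → ℝ` (K i.i.d. standard normal coordinates). -/
def stdGaussianPi (K : ℕ) : Measure (Fin K → ℝ) :=
  Measure.pi fun _ => gaussianReal 0 1

/-- `IsGaussianVec μ m C` means that `μ` is the Gaussian measure `N(m, C)` on `ℝ^K`,
realized as the law of `m + A ξ` where `A Aᵀ = C` and `ξ` is standard Gaussian. -/
def IsGaussianVec {K : ℕ} (μ : Measure (Fin K → ℝ)) (m : Fin K → ℝ)
    (C : Matrix (Fin K) (Fin K) ℝ) : Prop :=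
  ∃ A : Matrix (Fin K) (Fin K) ℝ, C = A * Aᵀ ∧
    μ = (stdGaussianPi K).map (fun ξ => m + A.mulVec ξ)

/-- The chi-squared distribution with `m` degrees of freedom: Gamma with shape `m/2`, rate `1/2`. -/
def chiSq (m : ℝ) : Measure ℝ := gammaMeasure (m / 2) (1 / 2)

/-- The Student t distribution with `df` degrees of freedom:
the law of `N / √(Q/df)` with `N` standard normal independent of `Q ~ χ²_df`. -/
def studentT (df : ℝ) : Measure ℝ :=
  ((gaussianReal 0 1).prod (chiSq df)).map fun p => p.1 / Real.sqrt (p.2 / df)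

/-- The `p`-quantile of the Student t distribution with `df` degrees of freedom. -/
def tQuantile (df p : ℝ) : ℝ :=
  sInf {x : ℝ | p ≤ (studentT df (Set.Iic x)).toReal}

/-- Convergence in distribution (weak convergence of laws) of `E`-valued random variables. -/
def TendstoInDist {Ω E : Type*} [MeasurableSpace Ω] [MeasurableSpace E] [TopologicalSpace E]
    (P : Measure Ω) (X : ℕ → Ω → E) (μ : Measure E) : Prop :=
  ∀ f : BoundedContinuousFunction E ℝ,
    Tendsto (fun n => ∫ ω, f (X n ω) ∂P) atTop (𝓝 (∫ x, f x ∂μ))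

end


lemma aux_map_eq_of_mgf {Ω Ω' : Type*} [MeasurableSpace Ω] [MeasurableSpace Ω']
    {X : Ω → ℝ} {Y : Ω' → ℝ} {μ : Measure Ω} {μ' : Measure Ω'} [IsFiniteMeasure μ]
    [IsFiniteMeasure μ'] (hXm : Measurable X) (hYm : Measurable Y) {ε : ℝ} (hε : 0 < ε)
    (hX : ∀ t < ε, Integrable (fun ω => Real.exp (t * X ω)) μ)
    (hY : ∀ t < ε, Integrable (fun ω => Real.exp (t * Y ω)) μ')
    (h : ∀ t < ε, mgf X μ t = mgf Y μ' t) : μ.map X = μ'.map Y := by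
  have hsX : Set.Iio ε ⊆ interior (integrableExpSet X μ) :=
    interior_maximal (fun t ht => hX t ht) isOpen_Iio
  have hsY : Set.Iio ε ⊆ interior (integrableExpSet Y μ') :=
    interior_maximal (fun t ht => hY t ht) isOpen_Iio
  have haX : AnalyticOnNhd ℂ (complexMGF X μ) {z | z.re ∈ Set.Iio ε} :=
    analyticOnNhd_complexMGF.mono fun z hz => hsX hz
  have haY : AnalyticOnNhd ℂ (complexMGF Y μ') {z | z.re ∈ Set.Iio ε} :=
    analyticOnNhd_complexMGF.mono fun z hz => hsY hz
  have hEq : Set.EqOn (complexMGF X μ) (complexMGF Y μ') {z | z.re ∈ Set.Iio ε} := by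
    refine AnalyticOnNhd.eqOn_of_preconnected_of_frequently_eq haX haY
      ((convex_Iio ε).linear_preimage Complex.reLm).isPreconnected
      (z₀ := ((0 : ℝ) : ℂ)) (by simpa using hε) ?_
    have h_real : ∃ᶠ (x : ℝ) in 𝓝[≠] 0, complexMGF X μ x = complexMGF Y μ' x := by
      refine Eventually.frequently ?_
      filter_upwards [mem_nhdsWithin_of_mem_nhds (Iio_mem_nhds hε)] with y hy
      rw [complexMGF_ofReal, complexMGF_ofReal, h y hy]
    rw [frequently_iff_seq_forall] at h_real ⊢
    obtain ⟨xs, hx_tendsto, hx_eq⟩ := h_real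
    refine ⟨fun n ↦ xs n, ?_, fun n ↦ ?_⟩
    · rw [tendsto_nhdsWithin_iff] at hx_tendsto ⊢
      constructor
      · exact (Complex.continuous_ofReal.tendsto 0).comp hx_tendsto.1
      · simpa using hx_tendsto.2
    · simp [hx_eq]
  apply Measure.ext_of_charFun
  ext t
  rw [← complexMGF_mul_I hXm.aemeasurable, ← complexMGF_mul_I hYm.aemeasurable]
  exact hEq (by simpa using hε)

lemma aux_integral_wd {Ω : Type*} [MeasurableSpace Ω] {μ : Measure Ω} {p : Ω → ℝ}
    (hp : Measurable p) (h0 : ∀ x, 0 ≤ p x) (g : Ω → ℝ) :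
    ∫ x, g x ∂(μ.withDensity fun x => ENNReal.ofReal (p x)) = ∫ x, p x * g x ∂μ := by
  rw [integral_withDensity_eq_integral_toReal_smul hp.ennreal_ofReal (by simp)]
  simp [h0]

lemma aux_integrable_wd {Ω : Type*} [MeasurableSpace Ω] {μ : Measure Ω} {p : Ω → ℝ}
    (hp : Measurable p) (h0 : ∀ x, 0 ≤ p x) (g : Ω → ℝ) :
    Integrable g (μ.withDensity fun x => ENNReal.ofReal (p x)) ↔
      Integrable (fun x => p x * g x) μ := by
  rw [integrable_withDensity_iff_integrable_smul' hp.ennreal_ofReal (by simp)]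
  simp [h0]

/-- Transfer of integrals of functions of `W` from equality of Laplace transforms. -/
lemma aux_complete {Ω : Type*} [MeasurableSpace Ω] {γ : Measure Ω} {W p q : Ω → ℝ}
    (hW : Measurable W) (hp : Measurable p) (hq : Measurable q) (hp0 : ∀ x, 0 ≤ p x)
    (hq0 : ∀ x, 0 ≤ q x) {ε : ℝ} (hε : 0 < ε)
    (hpi : ∀ t < ε, Integrable (fun x => p x * Real.exp (t * W x)) γ)
    (hqi : ∀ t < ε, Integrable (fun x => q x * Real.exp (t * W x)) γ)
    (h : ∀ t < ε, ∫ x, p x * Real.exp (t * W x) ∂γ = ∫ x, q x * Real.exp (t * W x) ∂γ)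
    (a : ℝ → ℝ) (ha : Measurable a) :
    ∫ x, p x * a (W x) ∂γ = ∫ x, q x * a (W x) ∂γ := by
  have hfin : ∀ r : Ω → ℝ, (Integrable (fun x => r x * Real.exp (0 * W x)) γ) →
      IsFiniteMeasure (γ.withDensity fun x => ENNReal.ofReal (r x)) := fun r hr => by
    refine isFiniteMeasure_withDensity_ofReal ?_
    simpa using hr.2
  have := hfin p (hpi 0 hε)
  have := hfin q (hqi 0 hε)
  have key := aux_map_eq_of_mgf (μ := γ.withDensity fun x => ENNReal.ofReal (p x))
    (μ' := γ.withDensity fun x => ENNReal.ofReal (q x)) hW hW hε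
    (fun t ht => (aux_integrable_wd hp hp0 _).2 (hpi t ht))
    (fun t ht => (aux_integrable_wd hq hq0 _).2 (hqi t ht))
    (fun t ht => by
      simp only [mgf]
      rw [aux_integral_wd hp hp0, aux_integral_wd hq hq0]; exact h t ht)
  have h2 : ∫ y, a y ∂(Measure.map W (γ.withDensity fun x => ENNReal.ofReal (p x)))
      = ∫ y, a y ∂(Measure.map W (γ.withDensity fun x => ENNReal.ofReal (q x))) := by rw [key]
  rw [integral_map hW.aemeasurable ha.aestronglyMeasurable,
    integral_map hW.aemeasurable ha.aestronglyMeasurable, aux_integral_wd hp hp0,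
    aux_integral_wd hq hq0] at h2
  exact h2

/-- The density of the standard Gaussian measure. -/
lemma aux_density (K : ℕ) : stdGaussianPi K = (volume : Measure (Fin K → ℝ)).withDensity
    (fun x => ENNReal.ofReal (∏ i, gaussianPDFReal 0 1 (x i))) := by
  refine Measure.pi_eq fun s hs => ?_
  rw [withDensity_apply _ (MeasurableSet.univ_pi hs), ← lintegral_indicator (MeasurableSet.univ_pi hs)]
  have h1 : ∀ x : Fin K → ℝ, (Set.univ.pi s).indicator
      (fun x => ENNReal.ofReal (∏ i, gaussianPDFReal 0 1 (x i))) x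
      = ENNReal.ofReal (∏ i, (s i).indicator (gaussianPDFReal 0 1) (x i)) := fun x => by
    by_cases hx : x ∈ Set.univ.pi s
    · rw [Set.indicator_of_mem hx]
      congr 1
      refine Finset.prod_congr rfl fun i _ => ?_
      rw [Set.indicator_of_mem (hx i trivial)]
    · rw [Set.indicator_of_notMem hx]
      simp only [Set.mem_pi, Set.mem_univ, true_imp_iff, not_forall] at hx
      obtain ⟨i, hi⟩ := hx
      rw [Finset.prod_eq_zero (Finset.mem_univ i) (Set.indicator_of_notMem hi _)]
      simp
  have hint : ∀ i, Integrable ((s i).indicator (gaussianPDFReal 0 1)) := fun i =>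
    (integrable_gaussianPDFReal 0 1).indicator (hs i)
  simp_rw [h1]
  rw [← ofReal_integral_eq_lintegral_ofReal]
  · rw [integral_fintype_prod_volume_eq_prod, ENNReal.ofReal_prod_of_nonneg]
    · refine Finset.prod_congr rfl fun i _ => ?_
      rw [integral_indicator (hs i), gaussianReal_apply_eq_integral 0 one_ne_zero]
    · intro i _
      exact integral_nonneg fun x => Set.indicator_nonneg (fun _ _ => gaussianPDFReal_nonneg _ _ _) _
  · exact Integrable.fintype_prod hint
  · exact .of_forall fun x => Finset.prod_nonneg fun i _ =>
      Set.indicator_nonneg (fun _ _ => gaussianPDFReal_nonneg _ _ _) _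

/-- squared Euclidean norm -/
def sqn {K : ℕ} (x : Fin K → ℝ) : ℝ := ∑ i, x i ^ 2

lemma measurable_sqn {K : ℕ} : Measurable (sqn : (Fin K → ℝ) → ℝ) := by
  unfold sqn; fun_prop

lemma aux_prodpdf (K : ℕ) (x : Fin K → ℝ) : ∏ i, gaussianPDFReal 0 1 (x i)
    = ((√(2 * Real.pi))⁻¹) ^ K * Real.exp (-(sqn x) / 2) := by
  simp [gaussianPDFReal_def, Finset.prod_mul_distrib, sqn, ← Real.exp_sum, Finset.sum_div,
    neg_div]

lemma aux_integral_gauss (K : ℕ) (f : (Fin K → ℝ) → ℝ) :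
    ∫ x, f x ∂(stdGaussianPi K) =
      ((√(2 * Real.pi))⁻¹) ^ K * ∫ x, Real.exp (-(sqn x) / 2) * f x := by
  rw [aux_density, aux_integral_wd]
  · simp_rw [aux_prodpdf, mul_assoc]
    rw [integral_const_mul]
  · simp_rw [aux_prodpdf]
    have := @measurable_sqn K
    fun_prop
  · intro x; exact Finset.prod_nonneg fun i _ => gaussianPDFReal_nonneg _ _ _

lemma aux_scale (K : ℕ) (f : (Fin K → ℝ) → ℝ) {τ : ℝ} (hτ : 0 < τ) :
    ∫ x, f (τ • x) ∂(stdGaussianPi K) =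
      (τ ^ K)⁻¹ * ∫ x, f x * Real.exp ((1 / 2 - 1 / (2 * τ ^ 2)) * sqn x) ∂(stdGaussianPi K) := by
  rw [aux_integral_gauss, aux_integral_gauss]
  have h := Measure.integral_comp_smul (volume : Measure (Fin K → ℝ))
    (fun x => Real.exp (-(sqn x) / (2 * τ ^ 2)) * f x) τ
  have h2 : ∀ x : Fin K → ℝ, sqn (τ • x) = τ ^ 2 * sqn x := fun x => by
    simp [sqn, mul_pow, Finset.mul_sum]
  have h3 : ∀ x : Fin K → ℝ, -(sqn (τ • x)) / (2 * τ ^ 2) = - sqn x / 2 := fun x => by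
    rw [h2]; field_simp
  simp only [h3] at h
  rw [h]
  have h4 : ∀ x : Fin K → ℝ, Real.exp (-(sqn x) / 2) *
      (f x * Real.exp ((1 / 2 - 1 / (2 * τ ^ 2)) * sqn x))
      = Real.exp (-(sqn x) / (2 * τ ^ 2)) * f x := fun x => by
    rw [mul_comm (f x), ← mul_assoc, ← Real.exp_add]
    congr 2; ring
  simp only [h4]
  rw [Module.finrank_fin_fun, abs_of_nonneg (by positivity)]
  simp only [smul_eq_mul]; ring

lemma aux_shift (n : ℕ) (f : (Fin (n+1) → ℝ) → ℝ) (θ : ℝ) :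
    ∫ x, f (x + Pi.single 0 θ) ∂(stdGaussianPi (n+1)) =
      Real.exp (-θ ^ 2 / 2) * ∫ x, f x * Real.exp (θ * x 0) ∂(stdGaussianPi (n+1)) := by
  rw [aux_integral_gauss, aux_integral_gauss]
  have h := integral_add_right_eq_self (μ := (volume : Measure (Fin (n+1) → ℝ)))
    (fun x => Real.exp (-(sqn (x - Pi.single 0 θ)) / 2) * f x) (Pi.single 0 θ)
  simp only [add_sub_cancel_right] at h
  rw [h, mul_left_comm, ← integral_const_mul (Real.exp _)]
  congr 1
  refine integral_congr_ae (.of_forall fun x => ?_)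
  have h2 : sqn (x - Pi.single 0 θ) = sqn x - 2 * θ * x 0 + θ ^ 2 := by
    simp [sqn, Fin.sum_univ_succ]; ring
  simp only [h2]
  rw [mul_comm (f x), ← mul_assoc, ← mul_assoc, ← Real.exp_add, ← Real.exp_add]
  congr 2; ring

instance (K : ℕ) : IsProbabilityMeasure (stdGaussianPi K) := by
  unfold stdGaussianPi; infer_instance

lemma aux_int_exp (K : ℕ) {t : ℝ} (ht : t < 1 / 2) :
    Integrable (fun x => Real.exp (t * sqn x)) (stdGaussianPi K) := by
  rw [aux_density, aux_integrable_wd]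
  · have h : ∀ x : Fin K → ℝ, (∏ i, gaussianPDFReal 0 1 (x i)) * Real.exp (t * sqn x)
        = ((√(2 * Real.pi))⁻¹) ^ K * ∏ i, Real.exp (-(1 / 2 - t) * (x i) ^ 2) := fun x => by
      rw [aux_prodpdf, mul_assoc, ← Real.exp_add, ← Real.exp_sum, ← Finset.mul_sum]
      congr 2
      simp only [sqn]; ring
    simp_rw [h]
    refine Integrable.const_mul ?_ _
    exact Integrable.fintype_prod (f := fun _ y => Real.exp (-(1 / 2 - t) * y ^ 2))
      fun i => integrable_exp_neg_mul_sq (by linarith)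
  · simp_rw [aux_prodpdf]
    have := @measurable_sqn K
    fun_prop
  · intro x; exact Finset.prod_nonneg fun i _ => gaussianPDFReal_nonneg _ _ _


lemma aux_int_bound {K : ℕ} {f : (Fin K → ℝ) → ℝ} (hf : Measurable f) {C t : ℝ} (ht : t < 1 / 2)
    (h : ∀ x, |f x| ≤ C * Real.exp (t * sqn x)) : Integrable f (stdGaussianPi K) :=
  ((aux_int_exp K ht).const_mul C).mono' hf.aestronglyMeasurable (.of_forall h)

lemma aux_sq_le {n : ℕ} (x : Fin (n+1) → ℝ) : x 0 ^ 2 ≤ sqn x :=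
  Finset.single_le_sum (f := fun i => x i ^ 2) (fun _ _ => sq_nonneg _) (Finset.mem_univ 0)

lemma aux_min {n : ℕ} {g : (Fin (n+1) → ℝ) → ℝ} (hg : Measurable g)
    (hg01 : ∀ x, g x ∈ Set.Icc (0 : ℝ) 1) {α : ℝ}
    (h0 : ∫ x, g x ∂(stdGaussianPi (n+1)) ≤ α)
    (h1 : ∀ s : ℝ, s ≠ 0 → α ≤ ∫ x, g (x + Pi.single 0 s) ∂(stdGaussianPi (n+1))) :
    ∫ x, g x ∂(stdGaussianPi (n+1)) = α ∧ ∫ x, g x * x 0 ∂(stdGaussianPi (n+1)) = 0 := by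
  set γ := stdGaussianPi (n+1)
  set X : (Fin (n+1) → ℝ) → ℝ := fun x => x 0
  have hint : ∀ s : ℝ, Integrable (fun x => g x * Real.exp (s * X x)) γ := fun s => by
    refine aux_int_bound (C := Real.exp (s ^ 2)) (t := 1 / 4) (by fun_prop) (by norm_num) fun x => ?_
    rw [abs_mul, abs_of_nonneg (hg01 x).1, abs_of_pos (Real.exp_pos _), ← Real.exp_add]
    calc g x * Real.exp (s * X x) ≤ 1 * Real.exp (s * X x) := by
          gcongr; exact (hg01 x).2
      _ ≤ _ := by
          rw [one_mul]; gcongr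
          have := aux_sq_le x
          simp only [X]
          nlinarith [sq_nonneg (s - x 0 / 2)]
  have hset : integrableExpSet X (γ.withDensity fun x => ENNReal.ofReal (g x)) = Set.univ := by
    ext s
    simp only [integrableExpSet, Set.mem_ofPred_eq, Set.mem_univ, iff_true]
    exact (aux_integrable_wd hg (fun x => (hg01 x).1) _).2 (hint s)
  have hd := hasDerivAt_mgf (X := X) (μ := γ.withDensity fun x => ENNReal.ofReal (g x)) (t := 0)
    (by rw [hset]; simp)
  have hd2 : HasDerivAt (fun s : ℝ => Real.exp (-s ^ 2 / 2)) 0 0 := by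
    have : HasDerivAt (fun s : ℝ => -s ^ 2 / 2) 0 0 := by
      simpa using ((hasDerivAt_pow 2 (0:ℝ)).neg.div_const 2)
    simpa using this.exp
  have hd3 := hd2.mul hd
  have hform : ∀ s, ∫ x, g (x + Pi.single 0 s) ∂γ =
      ((fun s : ℝ => Real.exp (-s ^ 2 / 2)) * mgf X (γ.withDensity fun x => ENNReal.ofReal (g x))) s
      := fun s => by
    rw [aux_shift, Pi.mul_apply, mgf, aux_integral_wd hg (fun x => (hg01 x).1)]
  set H := ((fun s : ℝ => Real.exp (-s ^ 2 / 2)) *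
    mgf X (γ.withDensity fun x => ENNReal.ofReal (g x)))
  have hH0 : H 0 = ∫ x, g x ∂γ := by rw [← hform]; simp
  have hge : α ≤ H 0 := by
    have hc : Tendsto H (𝓝[≠] 0) (𝓝 (H 0)) := hd3.continuousAt.tendsto.mono_left nhdsWithin_le_nhds
    refine ge_of_tendsto hc ?_
    filter_upwards [self_mem_nhdsWithin] with s hs
    rw [← hform]; exact h1 s hs
  have hEq : ∫ x, g x ∂γ = α := le_antisymm h0 (hH0 ▸ hge)
  refine ⟨hEq, ?_⟩
  have hmin : IsLocalMin H 0 := by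
    refine .of_forall fun s => ?_
    rcases eq_or_ne s 0 with rfl | hs
    · exact le_rfl
    · rw [hH0, hEq, ← hform]; exact h1 s hs
  have := hmin.hasDerivAt_eq_zero hd3
  rw [aux_integral_wd hg (fun x => (hg01 x).1)] at this
  simpa [X] using this

lemma aux_secant (θ : ℝ) {r T : ℝ} (hr : 0 < r) :
    (|T| ≤ r → Real.exp (θ * T) ≤ Real.cosh (θ * r) + Real.sinh (θ * r) / r * T) ∧
    (r < |T| → Real.cosh (θ * r) + Real.sinh (θ * r) / r * T ≤ Real.exp (θ * T)) := by
  have hconv : ConvexOn ℝ Set.univ (fun y : ℝ => Real.exp (θ * y)) := by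
    have := convexOn_exp.comp_linearMap (LinearMap.mul ℝ ℝ θ)
    simpa [Function.comp_def] using this
  have hc2 : ∀ x y a b : ℝ, 0 ≤ a → 0 ≤ b → a + b = 1 →
      Real.exp (θ * (a * x + b * y)) ≤ a * Real.exp (θ * x) + b * Real.exp (θ * y) :=
    fun x y a b ha hb hab => hconv.2 (Set.mem_univ x) (Set.mem_univ y) ha hb hab
  have hl : Real.cosh (θ * r) + Real.sinh (θ * r) / r * T =
      ((r + T) / (2 * r)) * Real.exp (θ * r) + ((r - T) / (2 * r)) * Real.exp (θ * -r) := by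
    rw [Real.cosh_eq, Real.sinh_eq, mul_neg]; field_simp; ring
  constructor
  · intro hT
    rw [abs_le] at hT
    have := hc2 r (-r) ((r + T) / (2 * r))
      ((r - T) / (2 * r)) (div_nonneg (by linarith) (by linarith))
      (div_nonneg (by linarith) (by linarith)) (by field_simp; ring)
    have e : ((r + T) / (2 * r)) * r + ((r - T) / (2 * r)) * (-r) = T := by
      field_simp; ring
    rw [e] at this
    rw [hl]; exact this
  · intro hT
    rcases lt_abs.1 hT with h | h
    · -- `r` lies between `-r` and `T`
      have := hc2 T (-r) (2 * r / (r + T))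
        ((T - r) / (r + T)) (div_nonneg (by linarith) (by linarith))
        (div_nonneg (by linarith) (by linarith)) (by rw [← add_div]; rw [div_eq_one_iff_eq] <;> linarith)
      have hp : 0 < r + T := by linarith
      have e : (2 * r / (r + T)) * T + ((T - r) / (r + T)) * (-r) = r := by
        field_simp; ring
      rw [e] at this
      rw [hl]
      have h2 := mul_le_mul_of_nonneg_left this (show 0 ≤ (r + T) / (2 * r) by positivity)
      have h3 : (r + T) / (2 * r) * (2 * r / (r + T) * Real.exp (θ * T) + (T - r) / (r + T) * Real.exp (θ * -r))
        = Real.exp (θ * T) - (r - T) / (2 * r) * Real.exp (θ * -r) := by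
        field_simp; ring
      linarith
    · have := hc2 T r (2 * r / (r - T))
        ((-T - r) / (r - T)) (div_nonneg (by linarith) (by linarith))
        (div_nonneg (by linarith) (by linarith)) (by rw [← add_div]; rw [div_eq_one_iff_eq] <;> linarith)
      have hp : 0 < r - T := by linarith
      have e : (2 * r / (r - T)) * T + ((-T - r) / (r - T)) * r = -r := by
        field_simp; ring
      rw [e] at this
      rw [hl]
      have h2 := mul_le_mul_of_nonneg_left this (show 0 ≤ (r - T) / (2 * r) by positivity)
      have h3 : (r - T) / (2 * r) * (2 * r / (r - T) * Real.exp (θ * T) + (-T - r) / (r - T) * Real.exp (θ * r))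
        = Real.exp (θ * T) - (r + T) / (2 * r) * Real.exp (θ * r) := by
        field_simp; ring
      linarith


lemma aux_odd {K : ℕ} {f : (Fin K → ℝ) → ℝ} (hf : ∀ x, f (-x) = - f x) :
    ∫ x, f x ∂(stdGaussianPi K) = 0 := by
  rw [aux_integral_gauss]
  have h := integral_neg_eq_self (fun x : Fin K → ℝ => Real.exp (-(sqn x) / 2) * f x) volume
  have h2 : ∀ x : Fin K → ℝ, sqn (-x) = sqn x := fun x => by simp [sqn]
  simp only [hf, h2, mul_neg, integral_neg] at h
  have : ∫ x : Fin K → ℝ, Real.exp (-(sqn x) / 2) * f x = 0 := by linarith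
  rw [this, mul_zero]

lemma aux_T_bound {n : ℕ} (x : Fin (n+1) → ℝ) {δ : ℝ} (hδ : 0 < δ) :
    |x 0| ≤ (1 + 1 / δ) * Real.exp (δ * sqn x) := by
  have h1 := aux_sq_le x
  have h2 : δ * sqn x + 1 ≤ Real.exp (δ * sqn x) := Real.add_one_le_exp _
  have h3 : |x 0| ≤ 1 + x 0 ^ 2 := by
    rw [← sq_abs]; nlinarith [sq_nonneg (|x 0| - 1), abs_nonneg (x 0)]
  have h0 : 0 ≤ sqn x := le_trans (sq_nonneg _) h1
  have h4 : 1 ≤ Real.exp (δ * sqn x) := Real.one_le_exp (by positivity)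
  have h5 : sqn x ≤ 1 / δ * Real.exp (δ * sqn x) := by
    rw [one_div, ← div_eq_inv_mul, le_div_iff₀ hδ]; nlinarith
  nlinarith

theorem aux_umpu {n : ℕ} {c : ℝ} (hc0 : 0 < c) (hc1 : c ≤ 1) {α : ℝ}
    {φ ψ : (Fin (n+1) → ℝ) → ℝ} (hφ : Measurable φ) (hφ01 : ∀ x, φ x ∈ Set.Icc (0 : ℝ) 1)
    (hψ : ψ = Set.indicator {x | c * √(sqn x) < |x 0|} 1)
    (hψα : ∫ x, ψ x ∂(stdGaussianPi (n+1)) = α)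
    (h0 : ∀ τ : ℝ, 0 < τ → ∫ x, φ (τ • x) ∂(stdGaussianPi (n+1)) ≤ α)
    (h1 : ∀ θ : ℝ, θ ≠ 0 → ∀ τ : ℝ, 0 < τ →
      α ≤ ∫ x, φ (τ • x + Pi.single 0 θ) ∂(stdGaussianPi (n+1))) (θ : ℝ) :
    ∫ x, φ (x + Pi.single 0 θ) ∂(stdGaussianPi (n+1)) ≤
      ∫ x, ψ (x + Pi.single 0 θ) ∂(stdGaussianPi (n+1)) := by
  have hWm := @measurable_sqn (n+1)
  have hψm : Measurable ψ := by
    rw [hψ]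
    refine measurable_one.indicator (measurableSet_lt (by fun_prop) (by fun_prop))
  have hψ01 : ∀ x, ψ x ∈ Set.Icc (0 : ℝ) 1 := fun x => by
    rw [hψ]
    by_cases h : c * √(sqn x) < |x 0| <;> simp [Set.indicator, h]
  have hsq : ∀ (τ : ℝ) (x : Fin (n+1) → ℝ), sqn (τ • x) = τ ^ 2 * sqn x := fun τ x => by
    simp [sqn, mul_pow, Finset.mul_sum]
  have hψc : ∀ x y : Fin (n+1) → ℝ, (c * √(sqn x) < |x 0| ↔ c * √(sqn y) < |y 0|) → ψ x = ψ y :=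
    fun x y hxy => by
    rw [hψ]
    by_cases h : c * √(sqn y) < |y 0|
    · rw [Set.indicator_of_mem (show y ∈ {x : Fin (n+1) → ℝ | c * √(sqn x) < |x 0|} from h),
        Set.indicator_of_mem (show x ∈ {x : Fin (n+1) → ℝ | c * √(sqn x) < |x 0|} from hxy.2 h)]
      rfl
    · rw [Set.indicator_of_notMem (show y ∉ {x : Fin (n+1) → ℝ | c * √(sqn x) < |x 0|} from h),
        Set.indicator_of_notMem (show x ∉ {x : Fin (n+1) → ℝ | c * √(sqn x) < |x 0|} from
          fun h' => h (hxy.1 h'))]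
  have hψτ : ∀ τ : ℝ, 0 < τ → ∀ x, ψ (τ • x) = ψ x := fun τ hτ x => by
    have : c * √(sqn (τ • x)) < |(τ • x) 0| ↔ c * √(sqn x) < |x 0| := by
      rw [hsq, Real.sqrt_mul (by positivity), Real.sqrt_sq hτ.le, Pi.smul_apply, smul_eq_mul,
        abs_mul, abs_of_pos hτ, mul_left_comm]
      exact mul_lt_mul_iff_right₀ hτ
    exact hψc _ _ this
  have hψneg : ∀ x, ψ (-x) = ψ x := fun x => by
    refine hψc _ _ ?_
    simp [sqn]
  set γ := stdGaussianPi (n+1) with hγ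
  -- similarity and zero derivative
  have hsim : ∀ τ : ℝ, 0 < τ → ∫ x, φ (τ • x) ∂γ = α ∧ ∫ x, φ (τ • x) * x 0 ∂γ = 0 :=
    fun τ hτ => by
    refine aux_min (g := fun x => φ (τ • x)) (by fun_prop) (fun x => hφ01 _) (h0 τ hτ) fun s hs => ?_
    have := h1 (τ * s) (mul_ne_zero hτ.ne' hs) τ hτ
    convert this using 4 with x
    rw [smul_add, ← Pi.single_smul, smul_eq_mul]
  -- Laplace transforms
  have hτ : ∀ t : ℝ, t < 1 / 2 → ∃ τ : ℝ, 0 < τ ∧ 1 / 2 - 1 / (2 * τ ^ 2) = t := fun t ht => by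
    have hpos : 0 < 1 - 2 * t := by linarith
    refine ⟨(√(1 - 2 * t))⁻¹, by positivity, ?_⟩
    rw [inv_pow, Real.sq_sqrt hpos.le]; field_simp; ring
  have hL1 : ∀ t : ℝ, t < 1 / 2 →
      ∫ x, φ x * Real.exp (t * sqn x) ∂γ = ∫ x, ψ x * Real.exp (t * sqn x) ∂γ := fun t ht => by
    obtain ⟨τ, hτ0, rfl⟩ := hτ t ht
    have e1 := aux_scale (n+1) φ hτ0
    have e2 := aux_scale (n+1) ψ hτ0
    simp only [hψτ τ hτ0, ← hγ] at e1 e2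
    rw [(hsim τ hτ0).1, ← hψα, e2] at e1
    exact (mul_left_cancel₀ (by positivity) e1).symm
  have hL2 : ∀ t : ℝ, t < 1 / 2 → ∫ x, φ x * x 0 * Real.exp (t * sqn x) ∂γ = 0 := fun t ht => by
    obtain ⟨τ, hτ0, rfl⟩ := hτ t ht
    have e1 := aux_scale (n+1) (fun x => φ x * x 0) hτ0
    simp only [Pi.smul_apply, smul_eq_mul, ← hγ] at e1
    have e2 : ∫ x, φ (τ • x) * (τ * x 0) ∂γ = 0 := by
      have : ∀ x : Fin (n+1) → ℝ, φ (τ • x) * (τ * x 0) = τ * (φ (τ • x) * x 0) :=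
        fun x => by ring
      simp_rw [this]
      rw [integral_const_mul, (hsim τ hτ0).2, mul_zero]
    rw [e2] at e1
    have hne : (τ ^ (n+1))⁻¹ ≠ 0 := by positivity
    exact (mul_eq_zero.1 e1.symm).resolve_left hne
  have hL3 : ∀ t : ℝ, ∫ x, ψ x * x 0 * Real.exp (t * sqn x) ∂γ = 0 := fun t => by
    refine aux_odd fun x => ?_
    have : sqn (-x) = sqn x := by simp [sqn]
    rw [hψneg, this]; simp
  -- integrability
  have hI0 : ∀ q : (Fin (n+1) → ℝ) → ℝ, Measurable q → (∀ x, |q x| ≤ 1) → ∀ t : ℝ, t < 1 / 2 →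
      Integrable (fun x => q x * Real.exp (t * sqn x)) γ := fun q hq hq1 t ht => by
    refine aux_int_bound (C := 1) (by fun_prop) ht fun x => ?_
    rw [abs_mul, abs_of_pos (Real.exp_pos _)]
    gcongr; exact hq1 x
  have hI1 : ∀ q : (Fin (n+1) → ℝ) → ℝ, Measurable q → (∀ x, |q x| ≤ |x 0|) → ∀ t : ℝ, t < 1 / 2 →
      Integrable (fun x => q x * Real.exp (t * sqn x)) γ := fun q hq hq1 t ht => by
    have hδ : 0 < (1 / 2 - t) / 2 := by linarith
    refine aux_int_bound (C := 1 + 1 / ((1 / 2 - t) / 2)) (t := t + (1 / 2 - t) / 2)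
      (by fun_prop) (by linarith) fun x => ?_
    rw [abs_mul, abs_of_pos (Real.exp_pos _), add_mul t, Real.exp_add, mul_comm (Real.exp (t * _)),
      ← mul_assoc]
    gcongr; exact (hq1 x).trans (aux_T_bound x hδ)
  -- the positive and negative parts
  set p1 : (Fin (n+1) → ℝ) → ℝ := fun x => φ x * max (x 0) 0 + ψ x * max (-x 0) 0 with hp1
  set p2 : (Fin (n+1) → ℝ) → ℝ := fun x => φ x * max (-x 0) 0 + ψ x * max (x 0) 0 with hp2
  have hp1m : Measurable p1 := by fun_prop
  have hp2m : Measurable p2 := by fun_prop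
  have hp10 : ∀ x, 0 ≤ p1 x := fun x => add_nonneg
    (mul_nonneg (hφ01 x).1 (le_max_right _ _)) (mul_nonneg (hψ01 x).1 (le_max_right _ _))
  have hp20 : ∀ x, 0 ≤ p2 x := fun x => add_nonneg
    (mul_nonneg (hφ01 x).1 (le_max_right _ _)) (mul_nonneg (hψ01 x).1 (le_max_right _ _))
  have habs : ∀ y : ℝ, max y 0 + max (-y) 0 = |y| := fun y => by
    rcases le_total 0 y with h | h
    · rw [max_eq_left h, max_eq_right (by linarith), abs_of_nonneg h, add_zero]
    · rw [max_eq_right h, max_eq_left (by linarith), abs_of_nonpos h, zero_add]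
  have hsub : ∀ y : ℝ, max y 0 - max (-y) 0 = y := fun y => by
    rcases le_total 0 y with h | h
    · rw [max_eq_left h, max_eq_right (by linarith), sub_zero]
    · rw [max_eq_right h, max_eq_left (by linarith)]; ring
  have hp1b : ∀ x, |p1 x| ≤ |x 0| := fun x => by
    rw [abs_of_nonneg (hp10 x), ← habs]
    exact add_le_add (mul_le_of_le_one_left (le_max_right _ _) (hφ01 x).2)
      (mul_le_of_le_one_left (le_max_right _ _) (hψ01 x).2)
  have hp2b : ∀ x, |p2 x| ≤ |x 0| := fun x => by
    rw [abs_of_nonneg (hp20 x), ← habs, add_comm (max _ _)]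
    exact add_le_add (mul_le_of_le_one_left (le_max_right _ _) (hφ01 x).2)
      (mul_le_of_le_one_left (le_max_right _ _) (hψ01 x).2)
  have hp12 : ∀ x, p1 x - p2 x = φ x * x 0 - ψ x * x 0 := fun x => by
    have := hsub (x 0)
    simp only [hp1, hp2]
    linear_combination (φ x - ψ x) * this
  have hφT : ∀ x, |φ x * x 0| ≤ |x 0| := fun x => by
    rw [abs_mul, abs_of_nonneg (hφ01 x).1]
    exact mul_le_of_le_one_left (abs_nonneg _) (hφ01 x).2
  have hψT : ∀ x, |ψ x * x 0| ≤ |x 0| := fun x => by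
    rw [abs_mul, abs_of_nonneg (hψ01 x).1]
    exact mul_le_of_le_one_left (abs_nonneg _) (hψ01 x).2
  have hφ1 : ∀ x, |φ x| ≤ 1 := fun x => by rw [abs_of_nonneg (hφ01 x).1]; exact (hφ01 x).2
  have hψ1 : ∀ x, |ψ x| ≤ 1 := fun x => by rw [abs_of_nonneg (hψ01 x).1]; exact (hψ01 x).2
  have hL4 : ∀ t : ℝ, t < 1 / 2 →
      ∫ x, p1 x * Real.exp (t * sqn x) ∂γ = ∫ x, p2 x * Real.exp (t * sqn x) ∂γ := fun t ht => by
    rw [← sub_eq_zero, ← integral_sub (hI1 p1 hp1m hp1b t ht) (hI1 p2 hp2m hp2b t ht)]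
    simp_rw [← sub_mul, hp12, sub_mul]
    rw [integral_sub (hI1 (fun x => φ x * x 0) (by fun_prop) hφT t ht)
      (hI1 (fun x => ψ x * x 0) (by fun_prop) hψT t ht), hL2 t ht, hL3, sub_zero]
  set a : ℝ → ℝ := fun w => Real.cosh (θ * (c * √w)) with ha
  set b : ℝ → ℝ := fun w => Real.sinh (θ * (c * √w)) / (c * √w) with hb
  have ham : Measurable a := by
    have : Continuous a := by fun_prop
    exact this.measurable
  have hbm : Measurable b := by
    have h1 : Continuous fun w => Real.sinh (θ * (c * √w)) := by fun_prop
    exact h1.measurable.div (by fun_prop)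
  have hA := aux_complete (γ := γ) hWm hφ hψm (fun x => (hφ01 x).1) (fun x => (hψ01 x).1)
    (ε := 1 / 2) (by norm_num) (hI0 φ hφ hφ1) (hI0 ψ hψm hψ1) hL1 a ham
  have hB := aux_complete (γ := γ) hWm hp1m hp2m hp10 hp20
    (ε := 1 / 2) (by norm_num) (hI1 p1 hp1m hp1b) (hI1 p2 hp2m hp2b) hL4 b hbm
  -- bounds
  have hexp : ∀ x : Fin (n+1) → ℝ, Real.exp |θ * (c * √(sqn x))| ≤
      Real.exp (θ ^ 2) * Real.exp (1 / 4 * sqn x) := fun x => by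
    rw [← Real.exp_add]
    gcongr
    have hW0 : 0 ≤ sqn x := le_trans (sq_nonneg _) (aux_sq_le x)
    have hs := Real.sq_sqrt hW0
    have hs0 := Real.sqrt_nonneg (sqn x)
    rw [abs_mul, abs_of_nonneg (by positivity : 0 ≤ c * √(sqn x)), ← sq_abs θ]
    have : |θ| * (c * √(sqn x)) ≤ |θ| * (1 * √(sqn x)) := by gcongr
    nlinarith [sq_nonneg (|θ| - √(sqn x) / 2)]
  have hcosh : ∀ y : ℝ, |Real.cosh y| ≤ Real.exp |y| := fun y => by
    rw [abs_of_pos (Real.cosh_pos y), ← Real.cosh_abs, Real.cosh_eq]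
    have : Real.exp (-|y|) ≤ Real.exp |y| := by gcongr; linarith [abs_nonneg y]
    linarith
  have hsinh : ∀ y : ℝ, |Real.sinh y| ≤ Real.exp |y| := fun y => by
    rw [Real.abs_sinh, Real.sinh_eq]
    have := Real.exp_pos (-|y|)
    have := Real.exp_pos (|y|)
    linarith
  have hIa : ∀ q : (Fin (n+1) → ℝ) → ℝ, Measurable q → (∀ x, |q x| ≤ 1) →
      Integrable (fun x => q x * a (sqn x)) γ := fun q hq hq1 => by
    refine aux_int_bound (C := Real.exp (θ ^ 2)) (t := 1 / 4) (by fun_prop) (by norm_num) fun x => ?_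
    rw [abs_mul]
    calc |q x| * |a (sqn x)| ≤ 1 * |a (sqn x)| := by gcongr; exact hq1 x
      _ ≤ _ := by rw [one_mul]; exact (hcosh _).trans (hexp x)
  have hIb : ∀ q : (Fin (n+1) → ℝ) → ℝ, Measurable q → (∀ x, |q x| ≤ |x 0|) →
      Integrable (fun x => q x * b (sqn x)) γ := fun q hq hq1 => by
    refine aux_int_bound (C := 1 / c * Real.exp (θ ^ 2)) (t := 1 / 4) (by fun_prop) (by norm_num)
      fun x => ?_
    rw [abs_mul]
    have hT : |x 0| ≤ √(sqn x) := Real.abs_le_sqrt (aux_sq_le x)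
    have hs0 := Real.sqrt_nonneg (sqn x)
    calc |q x| * |b (sqn x)| ≤ √(sqn x) * |b (sqn x)| := by gcongr; exact (hq1 x).trans hT
      _ ≤ 1 / c * Real.exp |θ * (c * √(sqn x))| := by
        simp only [hb]
        rw [abs_div, abs_of_nonneg (by positivity : 0 ≤ c * √(sqn x))]
        rcases hs0.eq_or_lt with h | h
        · rw [← h]; simp; positivity
        · have : √(sqn x) * (|Real.sinh (θ * (c * √(sqn x)))| / (c * √(sqn x)))
            = 1 / c * |Real.sinh (θ * (c * √(sqn x)))| := by field_simp
          rw [this]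
          gcongr; exact hsinh _
      _ ≤ _ := by rw [mul_assoc]; gcongr; exact hexp x
  have hIe : ∀ q : (Fin (n+1) → ℝ) → ℝ, Measurable q → (∀ x, |q x| ≤ 1) →
      Integrable (fun x => q x * Real.exp (θ * x 0)) γ := fun q hq hq1 => by
    refine aux_int_bound (C := Real.exp (θ ^ 2)) (t := 1 / 4) (by fun_prop) (by norm_num) fun x => ?_
    rw [abs_mul, abs_of_pos (Real.exp_pos _), ← Real.exp_add]
    calc |q x| * Real.exp (θ * x 0) ≤ 1 * Real.exp (θ * x 0) := by gcongr; exact hq1 x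
      _ ≤ _ := by
        rw [one_mul]; gcongr
        have := aux_sq_le x
        nlinarith [sq_nonneg (θ - x 0 / 2)]
  -- the pointwise inequality
  have hpt : ∀ x, φ x * Real.exp (θ * x 0) - ψ x * Real.exp (θ * x 0) ≤
      (φ x * a (sqn x) - ψ x * a (sqn x)) + (p1 x * b (sqn x) - p2 x * b (sqn x)) := fun x => by
    rw [← sub_mul (p1 x), hp12]
    suffices h : (φ x - ψ x) * (Real.exp (θ * x 0) - (a (sqn x) + b (sqn x) * x 0)) ≤ 0 by
      linarith
    have hs0 := Real.sqrt_nonneg (sqn x)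
    have hT : |x 0| ≤ √(sqn x) := Real.abs_le_sqrt (aux_sq_le x)
    rcases hs0.eq_or_lt with h | h
    · have hx0 : x 0 = 0 := by rw [← abs_eq_zero]; exact le_antisymm (h ▸ hT) (abs_nonneg _)
      simp [ha, hb, ← h, hx0]
    · have hr : 0 < c * √(sqn x) := by positivity
      obtain ⟨k1, k2⟩ := aux_secant θ (T := x 0) hr
      by_cases hx : c * √(sqn x) < |x 0|
      · have hψx : ψ x = 1 := by rw [hψ]; simp [Set.indicator, hx]
        refine mul_nonpos_of_nonpos_of_nonneg (by rw [hψx]; linarith [(hφ01 x).2]) ?_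
        have := k2 hx
        simp only [ha, hb]; linarith
      · have hψx : ψ x = 0 := by rw [hψ]; simp [Set.indicator, hx]
        refine mul_nonpos_of_nonneg_of_nonpos (by rw [hψx]; linarith [(hφ01 x).1]) ?_
        have := k1 (not_lt.1 hx)
        simp only [ha, hb]; linarith
  have hfin := integral_mono ((hIe φ hφ hφ1).sub (hIe ψ hψm hψ1))
    (((hIa φ hφ hφ1).sub (hIa ψ hψm hψ1)).add ((hIb p1 hp1m hp1b).sub (hIb p2 hp2m hp2b))) hpt
  simp only [Pi.add_apply, Pi.sub_apply] at hfin
  rw [integral_sub (hIe φ hφ hφ1) (hIe ψ hψm hψ1)] at hfin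
  have e3 := integral_add ((hIa φ hφ hφ1).sub (hIa ψ hψm hψ1))
    ((hIb p1 hp1m hp1b).sub (hIb p2 hp2m hp2b))
  simp only [Pi.add_apply, Pi.sub_apply] at e3
  rw [integral_sub (hIa φ hφ hφ1) (hIa ψ hψm hψ1),
    integral_sub (hIb p1 hp1m hp1b) (hIb p2 hp2m hp2b), hA, hB] at e3
  rw [hγ, aux_shift, aux_shift, ← hγ]
  refine mul_le_mul_of_nonneg_left ?_ (Real.exp_pos _).le
  linarith


lemma aux_gamma_mgf {a t : ℝ} (ha : 0 < a) (ht : t < 1 / 2) :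
    ∫ x, Real.exp (t * x) ∂(gammaMeasure a (1 / 2)) = (1 / (1 - 2 * t)) ^ a := by
  have hr : 0 < 1 / 2 - t := by linarith
  unfold gammaMeasure gammaPDF
  rw [aux_integral_wd (measurable_gammaPDFReal a (1 / 2))
    (fun x => gammaPDFReal_nonneg ha (by norm_num) x)]
  have h1 : ∀ x, gammaPDFReal a (1 / 2) x * Real.exp (t * x) =
      (Set.Ici 0).indicator (fun x => ((1 / 2 : ℝ) ^ a / Real.Gamma a) *
        (x ^ (a - 1) * Real.exp (-((1 / 2 - t) * x)))) x := fun x => by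
    unfold gammaPDFReal
    by_cases hx : 0 ≤ x
    · rw [if_pos hx, Set.indicator_of_mem (show x ∈ Set.Ici 0 from hx), mul_assoc, mul_assoc,
        ← Real.exp_add]
      congr 3; ring
    · rw [if_neg hx, Set.indicator_of_notMem (show x ∉ Set.Ici 0 from hx), zero_mul]
  simp_rw [h1]
  rw [integral_indicator measurableSet_Ici, integral_Ici_eq_integral_Ioi, integral_const_mul,
    Real.integral_rpow_mul_exp_neg_mul_Ioi ha hr]
  have hG := (Real.Gamma_pos_of_pos ha).ne'
  rw [show (1 : ℝ) / (1 - 2 * t) = (1 / 2) * (1 / (1 / 2 - t)) by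
    have : 1 - 2 * t ≠ 0 := by linarith
    field_simp, Real.mul_rpow (by norm_num) (by positivity)]
  field_simp

lemma aux_gauss_mgf (n : ℕ) {t : ℝ} (ht : t < 1 / 2) :
    ∫ x, Real.exp (t * sqn x) ∂(stdGaussianPi n) = (1 / (1 - 2 * t)) ^ ((n : ℝ) / 2) := by
  have hp : 0 < 1 - 2 * t := by linarith
  rw [aux_integral_gauss]
  have h : ∀ x : Fin n → ℝ, Real.exp (-(sqn x) / 2) * Real.exp (t * sqn x)
      = ∏ i, Real.exp (-(1 / 2 - t) * (x i) ^ 2) := fun x => by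
    rw [← Real.exp_add, ← Real.exp_sum, ← Finset.mul_sum]
    congr 1
    simp only [sqn]; ring
  simp_rw [h]
  rw [integral_fintype_prod_volume_eq_pow (fun y : ℝ => Real.exp (-(1 / 2 - t) * y ^ 2)),
    integral_gaussian, Fintype.card_fin, ← mul_pow, ← Real.sqrt_inv, ← Real.sqrt_mul (by positivity)]
  have e : (2 * Real.pi)⁻¹ * (Real.pi / (1 / 2 - t)) = 1 / (1 - 2 * t) := by
    have : 1 - 2 * t ≠ 0 := hp.ne'
    have h2 : 1 / 2 - t ≠ 0 := by linarith
    have := Real.pi_pos.ne'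
    field_simp
  rw [e, Real.sqrt_eq_rpow, ← Real.rpow_natCast, ← Real.rpow_mul (by positivity)]
  congr 1; ring

lemma aux_chi {n : ℕ} (hn : 1 ≤ n) : (stdGaussianPi n).map sqn = chiSq n := by
  have hn' : (0 : ℝ) < (n : ℝ) / 2 := by
    have : (1 : ℝ) ≤ n := by exact_mod_cast hn
    linarith
  have : IsProbabilityMeasure (gammaMeasure ((n : ℝ) / 2) (1 / 2)) :=
    isProbabilityMeasure_gammaMeasure hn' (by norm_num)
  unfold chiSq
  have h := aux_map_eq_of_mgf (X := sqn) (Y := id) (μ := stdGaussianPi n)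
    (μ' := gammaMeasure ((n : ℝ) / 2) (1 / 2)) measurable_sqn measurable_id (ε := 1 / 2)
    (by norm_num) (fun t ht => aux_int_exp n ht)
    (fun t ht => by
      by_contra hcon
      have h2 := aux_gamma_mgf hn' ht
      simp only [id] at hcon
      rw [integral_undef hcon] at h2
      have hp : 0 < 1 - 2 * t := by linarith
      have : 0 < (1 / (1 - 2 * t)) ^ ((n : ℝ) / 2) := by positivity
      linarith)
    (fun t ht => by
      simp only [mgf, id]
      rw [aux_gauss_mgf n ht, aux_gamma_mgf hn' ht])
  rw [Measure.map_id] at h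
  exact h

lemma aux_chi_prob {n : ℕ} (hn : 1 ≤ n) : IsProbabilityMeasure (chiSq n) := by
  rw [← aux_chi hn]
  exact Measure.isProbabilityMeasure_map measurable_sqn.aemeasurable

lemma aux_chi_pos (n : ℕ) : ∀ᵐ q ∂(chiSq n), 0 < q := by
  rw [ae_iff]
  have : {a : ℝ | ¬ 0 < a} = Set.Iic 0 := by ext; simp
  rw [this]
  unfold chiSq gammaMeasure
  rw [withDensity_apply _ measurableSet_Iic, ← setLIntegral_congr Iio_ae_eq_Iic]
  exact lintegral_gammaPDF_of_nonpos le_rfl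

lemma aux_meas_ratio (d : ℝ) : Measurable (fun p : ℝ × ℝ => p.1 / √(p.2 / d)) := by fun_prop

lemma aux_t_prob {n : ℕ} (hn : 1 ≤ n) : IsProbabilityMeasure (studentT n) := by
  have := aux_chi_prob hn
  exact Measure.isProbabilityMeasure_map (aux_meas_ratio n).aemeasurable

lemma aux_t_atom {n : ℕ} (hn : 1 ≤ n) (x : ℝ) : studentT n {x} = 0 := by
  have := aux_chi_prob hn
  have hn' : (0 : ℝ) < n := by exact_mod_cast hn
  have := nullSingletonClass_gaussianReal (μ := 0) (v := 1) one_ne_zero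
  have hms := (aux_meas_ratio n) (measurableSet_singleton x)
  rw [studentT, Measure.map_apply (aux_meas_ratio n) (measurableSet_singleton x),
    Measure.prod_apply_symm hms, lintegral_eq_zero_iff (measurable_measure_prodMk_right hms)]
  filter_upwards [aux_chi_pos n] with q hq
  have hs : 0 < √(q / n) := by positivity
  have : (fun y : ℝ => (y, q)) ⁻¹' ((fun p : ℝ × ℝ => p.1 / √(p.2 / n)) ⁻¹' {x}) = {x * √(q / n)} := by
    ext y
    simp only [Set.mem_preimage, Set.mem_singleton_iff]
    exact div_eq_iff hs.ne'
  rw [this]; simp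

lemma aux_t_symm {n : ℕ} (hn : 1 ≤ n) : (studentT n).map (fun x => -x) = studentT n := by
  have := aux_chi_prob hn
  have hN : (gaussianReal 0 1).map (fun x => -x) = gaussianReal 0 1 := by
    rw [gaussianReal_map_neg]; simp
  have hm : ((gaussianReal 0 1).prod (chiSq n)).map (fun p : ℝ × ℝ => (-p.1, p.2)) =
      (gaussianReal 0 1).prod (chiSq n) := by
    have h := Measure.map_prod_map (gaussianReal 0 1) (chiSq n) (f := fun x : ℝ => -x) (g := id)
      measurable_neg measurable_id
    rw [hN, Measure.map_id] at h
    exact h.symm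
  have h2 : (studentT n).map (fun x => -x) = (((gaussianReal 0 1).prod (chiSq n)).map
      (fun p : ℝ × ℝ => (-p.1, p.2))).map (fun p : ℝ × ℝ => p.1 / √(p.2 / n)) := by
    rw [studentT, Measure.map_map (by fun_prop) (by fun_prop),
      Measure.map_map (by fun_prop) (by fun_prop)]
    congr 1
    ext p
    simp [neg_div]
  rw [h2, hm]; rfl

lemma aux_quantile {ν : Measure ℝ} [IsProbabilityMeasure ν] (hat : ∀ x, ν {x} = 0) {p : ℝ}
    (hp : p ∈ Set.Ioo (0 : ℝ) 1) : (ν (Set.Iic (sInf {x : ℝ | p ≤ (ν (Set.Iic x)).toReal}))).toReal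
      = p := by
  have hF : ∀ x, (ν (Set.Iic x)).toReal = cdf ν x := fun x => by rw [cdf_eq_real]; rfl
  simp_rw [hF]
  have hcont : Continuous (cdf ν) := by
    rw [continuous_iff_continuousAt]
    intro x
    rw [(monotone_cdf ν).continuousAt_iff_leftLim_eq_rightLim, StieltjesFunction.rightLim_eq]
    have h1 := (cdf ν).measure_singleton x
    rw [measure_cdf, hat x] at h1
    have h2 := ENNReal.ofReal_eq_zero.1 h1.symm
    have h3 := (monotone_cdf ν).leftLim_le (le_refl x)
    linarith
  obtain ⟨x0, hx0⟩ : p ∈ Set.range (cdf ν) := by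
    obtain ⟨u, hu⟩ := ((tendsto_cdf_atBot ν).eventually (gt_mem_nhds hp.1)).exists
    obtain ⟨v, hv⟩ := ((tendsto_cdf_atTop ν).eventually (lt_mem_nhds hp.2)).exists
    exact mem_range_of_exists_le_of_exists_ge hcont ⟨u, hu.le⟩ ⟨v, hv.le⟩
  set S := {x : ℝ | p ≤ cdf ν x} with hS
  have hclosed : IsClosed S := isClosed_le continuous_const hcont
  have hne : S.Nonempty := ⟨x0, hx0.ge⟩
  have hbdd : BddBelow S := by
    obtain ⟨u, hu⟩ := ((tendsto_cdf_atBot ν).eventually (gt_mem_nhds hp.1)).exists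
    refine ⟨u, fun x hx => ?_⟩
    by_contra hlt
    have h1 : p ≤ cdf ν x := hx
    have := monotone_cdf ν (not_le.1 hlt).le
    linarith
  refine le_antisymm ?_ (hclosed.csInf_mem hne hbdd)
  rw [← hx0]
  exact monotone_cdf ν (csInf_le hbdd hx0.ge)

lemma aux_t_two {n : ℕ} (hn : 1 ≤ n) {α : ℝ} (hα : α ∈ Set.Ioo (0 : ℝ) 1) :
    0 < tQuantile n (1 - α / 2) ∧
    studentT n {x | tQuantile n (1 - α / 2) < |x|} = ENNReal.ofReal α := by
  have := aux_t_prob hn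
  have hat := aux_t_atom hn
  set ν := studentT n with hν
  set t := tQuantile n (1 - α / 2) with ht
  have hq : ν.real (Set.Iic t) = 1 - α / 2 :=
    aux_quantile hat ⟨by linarith [hα.2], by linarith [hα.1]⟩
  have hIoi : ∀ s, ν.real (Set.Ioi s) = 1 - ν.real (Set.Iic s) := fun s => by
    rw [← Set.compl_Iic, probReal_compl_eq_one_sub measurableSet_Iic]
  have hsymm : ∀ s, ν.real (Set.Iio (-s)) = ν.real (Set.Ioi s) := fun s => by
    conv_lhs => rw [hν, ← aux_t_symm hn]
    rw [map_measureReal_apply measurable_neg measurableSet_Iio]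
    congr 1
    ext x; simp
  have hIio : ∀ s, ν.real (Set.Iio s) = ν.real (Set.Iic s) := fun s => by
    rw [measureReal_def, measureReal_def]
    congr 1
    refine le_antisymm (measure_mono Set.Iio_subset_Iic_self) ?_
    rw [← Set.Iio_union_right]
    exact (measure_union_le _ _).trans (by rw [hat s, add_zero])
  have ht0 : 0 < t := by
    by_contra hcon
    have h1 : ν.real (Set.Iic t) ≤ ν.real (Set.Iic 0) :=
      measureReal_mono (Set.Iic_subset_Iic.2 (not_lt.1 hcon))
    have h2 := hsymm 0
    rw [neg_zero, hIio, hIoi] at h2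
    linarith [hα.2]
  refine ⟨ht0, ?_⟩
  have hset : {x : ℝ | t < |x|} = Set.Iio (-t) ∪ Set.Ioi t := by
    ext x
    simp only [Set.mem_ofPred_eq, Set.mem_union, Set.mem_Iio, Set.mem_Ioi, lt_abs]
    constructor
    · rintro (h | h)
      · exact Or.inr h
      · left; linarith
    · rintro (h | h)
      · right; linarith
      · exact Or.inl h
  have hdis : Disjoint (Set.Iio (-t)) (Set.Ioi t) := by
    rw [Set.disjoint_left]; intro x hx hx'
    simp only [Set.mem_Iio, Set.mem_Ioi] at hx hx'; linarith
  have hval : ν.real {x : ℝ | t < |x|} = α := by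
    rw [hset, measureReal_union hdis measurableSet_Ioi, hsymm, hIoi, hq]; ring
  rw [← hval, measureReal_def, ENNReal.ofReal_toReal (measure_ne_top _ _)]


lemma aux_size {n : ℕ} (hn : 1 ≤ n) {α : ℝ} (hα : α ∈ Set.Ioo (0 : ℝ) 1) :
    stdGaussianPi (n + 1) {x | tQuantile n (1 - α / 2) * √((∑ j : Fin n, x j.succ ^ 2) / n) < |x 0|}
      = ENNReal.ofReal α := by
  have := aux_chi_prob hn
  have hn' : (0 : ℝ) < n := by exact_mod_cast hn
  obtain ⟨ht0, ht⟩ := aux_t_two hn hα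
  set t := tQuantile n (1 - α / 2)
  have hmp := measurePreserving_piFinSuccAbove (fun _ : Fin (n + 1) => gaussianReal 0 1) 0
  have h2 : MeasurePreserving (fun p : ℝ × (Fin n → ℝ) => (p.1, sqn p.2))
      ((gaussianReal 0 1).prod (stdGaussianPi n)) ((gaussianReal 0 1).prod (chiSq n)) := by
    refine ⟨measurable_fst.prodMk (measurable_sqn.comp measurable_snd), ?_⟩
    have h := Measure.map_prod_map (gaussianReal 0 1) (stdGaussianPi n) (f := id) (g := sqn)
      measurable_id measurable_sqn
    rw [aux_chi hn, Measure.map_id] at h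
    exact h.symm
  have h3 := h2.comp hmp
  have hE : MeasurableSet {p : ℝ × ℝ | t * √(p.2 / n) < |p.1|} :=
    measurableSet_lt (by fun_prop) (by fun_prop)
  have hA := h3.measure_preimage hE.nullMeasurableSet
  have e1 : {x : Fin (n + 1) → ℝ | t * √((∑ j : Fin n, x j.succ ^ 2) / n) < |x 0|} =
      ((fun p : ℝ × (Fin n → ℝ) => (p.1, sqn p.2)) ∘
        (MeasurableEquiv.piFinSuccAbove (fun _ => ℝ) 0)) ⁻¹' {p : ℝ × ℝ | t * √(p.2 / n) < |p.1|} := by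
    ext x
    simp [sqn, MeasurableEquiv.piFinSuccAbove, Fin.insertNthEquiv, Fin.tail]
  rw [e1]
  refine hA.trans ?_
  rw [← ht, studentT, Measure.map_apply (aux_meas_ratio n) (measurableSet_lt (by fun_prop) (by fun_prop))]
  apply measure_congr
  have hq : ∀ᵐ p ∂((gaussianReal 0 1).prod (chiSq n)), 0 < p.2 :=
    Measure.quasiMeasurePreserving_snd.ae (aux_chi_pos n)
  filter_upwards [hq] with p hp
  apply propext
  have hs : 0 < √(p.2 / n) := by positivity
  change t * √(p.2 / n) < |p.1| ↔ t < |p.1 / √(p.2 / n)|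
  rw [abs_div, abs_of_pos hs, lt_div_iff₀ hs]

lemma aux_region {n : ℕ} (hn : 1 ≤ n) {t : ℝ} (ht : 0 < t) (x : Fin (n + 1) → ℝ) :
    t * √((∑ j : Fin n, x j.succ ^ 2) / n) < |x 0| ↔ (t / √(n + t ^ 2)) * √(sqn x) < |x 0| := by
  have hn' : (0 : ℝ) < n := by exact_mod_cast hn
  have hs : sqn x = x 0 ^ 2 + ∑ j : Fin n, x j.succ ^ 2 := by
    simp [sqn, Fin.sum_univ_succ]
  have hQ : 0 ≤ ∑ j : Fin n, x j.succ ^ 2 := Finset.sum_nonneg fun _ _ => sq_nonneg _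
  rw [hs]
  set Q := ∑ j : Fin n, x j.succ ^ 2
  rw [← abs_of_nonneg (show 0 ≤ t * √(Q / n) by positivity), ← sq_lt_sq,
    ← abs_of_nonneg (show 0 ≤ t / √(n + t ^ 2) * √(x 0 ^ 2 + Q) by positivity), ← sq_lt_sq,
    mul_pow, mul_pow, div_pow, Real.sq_sqrt (by positivity), Real.sq_sqrt (by positivity),
    Real.sq_sqrt (by positivity), mul_div_assoc', div_lt_iff₀ hn', div_mul_eq_mul_div,
    div_lt_iff₀ (by positivity)]
  constructor <;> intro h <;> linarith


lemma sqn_eq_dot {K : ℕ} (x : Fin K → ℝ) : sqn x = x ⬝ᵥ x := by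
  simp [sqn, dotProduct, sq]

lemma aux_rot {n : ℕ} (u : Fin (n + 1) → ℝ) (hu : sqn u = 1) :
    ∃ O : Matrix (Fin (n + 1)) (Fin (n + 1)) ℝ, O * Oᵀ = 1 ∧ O *ᵥ (Pi.single 0 1) = u := by
  by_cases hd : u = Pi.single 0 1
  · exact ⟨1, by simp, by rw [one_mulVec, hd]⟩
  set d : Fin (n + 1) → ℝ := Pi.single 0 1 - u with hdd
  have hd2 : d ⬝ᵥ d = 2 * d 0 := by
    rw [sqn_eq_dot] at hu
    simp only [hdd, sub_dotProduct, dotProduct_sub, hu]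
    simp
    ring
  have hne : d ⬝ᵥ d ≠ 0 := by
    rw [Ne, dotProduct_self_eq_zero, hdd, sub_eq_zero]
    exact fun h => hd h.symm
  have hd0 : d 0 ≠ 0 := fun h => hne (by rw [hd2, h, mul_zero])
  have hsym : (vecMulVec d d)ᵀ = vecMulVec d d := by
    ext i j; simp [vecMulVec_apply, mul_comm]
  refine ⟨1 - (1 / d 0) • vecMulVec d d, ?_, ?_⟩
  · rw [transpose_sub, transpose_one, transpose_smul, hsym, sub_mul, mul_sub, mul_sub]
    simp only [one_mul, mul_one, smul_mul_smul_comm, vecMulVec_mul_vecMulVec, hd2]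
    ext i j
    simp [vecMulVec_apply]
    field_simp
    ring
  · rw [sub_mulVec, one_mulVec, smul_mulVec, vecMulVec_mulVec]
    ext i
    simp
    field_simp
    simp [hdd]

lemma aux_gauss_rot {K : ℕ} (O : Matrix (Fin K) (Fin K) ℝ) (hO : O * Oᵀ = 1) :
    (stdGaussianPi K).map (fun x => O *ᵥ x) = stdGaussianPi K := by
  have hdet : O.det * O.det = 1 := by
    have := congrArg det hO
    simpa using this
  have hne : O.det ≠ 0 := fun h => by simp [h] at hdet
  have habs : |(O.det)⁻¹| = 1 := by
    have : |O.det| = 1 := by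
      rcases mul_self_eq_one_iff.1 hdet with h | h <;> simp [h]
    rw [abs_inv, this, inv_one]
  have hO' : Oᵀ * O = 1 := mul_eq_one_comm.1 hO
  have hmp : MeasurePreserving (fun x => O *ᵥ x) (volume : Measure (Fin K → ℝ)) volume := by
    refine ⟨by fun_prop, ?_⟩
    have h := Real.map_matrix_volume_pi_eq_smul_volume_pi hne
    rw [habs, ENNReal.ofReal_one, one_smul] at h
    exact h
  have hsq : ∀ x, sqn (O *ᵥ x) = sqn x := fun x => by
    rw [sqn_eq_dot, sqn_eq_dot, dotProduct_mulVec, ← mulVec_transpose, mulVec_mulVec, hO', one_mulVec]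
  rw [aux_density]
  simp_rw [aux_prodpdf]
  have hms := @measurable_sqn K
  have hf : Measurable (fun x : Fin K → ℝ =>
    ENNReal.ofReal (((√(2 * Real.pi))⁻¹) ^ K * Real.exp (-(sqn x) / 2))) := by fun_prop
  ext s hs
  rw [Measure.map_apply hmp.measurable hs, withDensity_apply _ (hmp.measurable hs),
    withDensity_apply _ hs, ← hmp.setLIntegral_comp_preimage hs hf]
  simp_rw [hsq]

lemma aux_frame {n : ℕ} {Sig : Matrix (Fin (n + 1)) (Fin (n + 1)) ℝ} (hSig : Sig.PosDef)
    {σ : ℝ} (hσ : 0 < σ) {A : Matrix (Fin (n + 1)) (Fin (n + 1)) ℝ}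
    (hA : σ ^ 2 • Sig = A * Aᵀ) :
    ∃ (B : Matrix (Fin (n + 1)) (Fin (n + 1)) ℝ) (s : ℝ), 0 < s ∧ σ ^ 2 • Sig = B * Bᵀ ∧
      B *ᵥ (Pi.single 0 s) = 1 ∧
      (∀ x y, (B *ᵥ y) ⬝ᵥ (Sig⁻¹ *ᵥ (B *ᵥ x)) = σ ^ 2 * (y ⬝ᵥ x)) ∧
      (∀ m : Fin (n + 1) → ℝ, (stdGaussianPi (n + 1)).map (fun ξ => m + A *ᵥ ξ) =
        (stdGaussianPi (n + 1)).map (fun ξ => m + B *ᵥ ξ)) := by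
  have hσ2 : σ ^ 2 ≠ 0 := by positivity
  have hdetS : IsUnit Sig.det := hSig.det_pos.ne'.isUnit
  have hdetA : IsUnit A.det := by
    have h := congrArg det hA
    rw [det_smul, det_mul, det_transpose] at h
    refine Ne.isUnit fun h0 => ?_
    rw [h0, mul_zero] at h
    exact (mul_ne_zero (pow_ne_zero _ hσ2) hSig.det_pos.ne') h
  set v : Fin (n + 1) → ℝ := A⁻¹ *ᵥ 1 with hv
  have hAv : A *ᵥ v = 1 := by rw [hv, mulVec_mulVec, mul_nonsing_inv _ hdetA, one_mulVec]
  have hvne : v ≠ 0 := fun h => by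
    rw [h, mulVec_zero] at hAv
    have := congrFun hAv 0
    simp at this
  have hq : 0 < sqn v := by
    rw [sqn_eq_dot]
    refine lt_of_le_of_ne ?_ fun h => hvne (dotProduct_self_eq_zero.1 h.symm)
    rw [← sqn_eq_dot]; exact Finset.sum_nonneg fun _ _ => sq_nonneg _
  set s := √(sqn v) with hs
  have hs0 : 0 < s := Real.sqrt_pos.2 hq
  have hss : s ^ 2 = sqn v := Real.sq_sqrt hq.le
  obtain ⟨O, hO, hOu⟩ := aux_rot (s⁻¹ • v) (by
    rw [sqn_eq_dot, smul_dotProduct, dotProduct_smul, ← sqn_eq_dot, ← hss]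
    simp only [smul_eq_mul]; field_simp)
  have hB : σ ^ 2 • Sig = (A * O) * (A * O)ᵀ := by
    rw [transpose_mul, Matrix.mul_assoc, ← Matrix.mul_assoc O, hO, Matrix.one_mul, hA]
  have hdetB : IsUnit (A * O).det := by
    rw [det_mul]
    refine hdetA.mul ?_
    have := congrArg det hO
    rw [det_mul, det_one] at this
    exact IsUnit.of_mul_eq_one _ this
  refine ⟨A * O, s, hs0, hB, ?_, ?_, ?_⟩
  · have : (Pi.single 0 s : Fin (n + 1) → ℝ) = s • Pi.single 0 1 := by
      ext i; simp [Pi.single_apply]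
    rw [this, mulVec_smul, ← mulVec_mulVec, hOu, mulVec_smul, hAv, smul_smul,
      mul_inv_cancel₀ hs0.ne', one_smul]
  · set B := A * O
    have hinv : Sig⁻¹ * (B * Bᵀ) = σ ^ 2 • 1 := by
      rw [← hB, Matrix.mul_smul, nonsing_inv_mul _ hdetS]
    have hdetBt : IsUnit (Bᵀ).det := by rwa [det_transpose]
    have key : Bᵀ * (Sig⁻¹ * B) = σ ^ 2 • 1 := by
      have h1 : Sig⁻¹ * B = σ ^ 2 • (Bᵀ)⁻¹ := by
        calc Sig⁻¹ * B = Sig⁻¹ * (B * Bᵀ) * (Bᵀ)⁻¹ := by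
              rw [Matrix.mul_assoc, Matrix.mul_assoc, mul_nonsing_inv _ hdetBt, Matrix.mul_one]
          _ = _ := by rw [hinv, Matrix.smul_mul, Matrix.one_mul]
      rw [h1, Matrix.mul_smul, mul_nonsing_inv _ hdetBt]
    intro x y
    have h2 : (B *ᵥ y) ⬝ᵥ (Sig⁻¹ *ᵥ (B *ᵥ x)) = y ⬝ᵥ (Bᵀ *ᵥ (Sig⁻¹ *ᵥ (B *ᵥ x))) := by
      rw [dotProduct_mulVec y, vecMul_transpose]
    rw [h2, mulVec_mulVec, mulVec_mulVec, Matrix.mul_assoc, key, smul_mulVec, one_mulVec, dotProduct_smul,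
      smul_eq_mul]
  · intro m
    conv_lhs => rw [← aux_gauss_rot O hO]
    rw [Measure.map_map (by fun_prop) (by fun_prop)]
    congr 1
    ext ξ
    simp [mulVec_mulVec]


/-- The test rejecting when `|m(z - μ₀1)| > t_{K-1,1-α/2} S(z)` has exact size
`α` for every `σ > 0`, and is uniformly most powerful unbiased at level `α` for testing
`H₀ : μ = μ₀` in the family `{N(μ 1_K, σ² Σ) : μ ∈ ℝ, σ² > 0}`. -/
theorem stmt0 (K : ℕ) (hK : 2 ≤ K) (Sig : Matrix (Fin K) (Fin K) ℝ) (hSig : Sig.PosDef)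
    (α μ₀ : ℝ) (hα : α ∈ Set.Ioo (0 : ℝ) 1)
    (lam : ℝ) (hlam : lam = (1 : Fin K → ℝ) ⬝ᵥ Sig⁻¹.mulVec 1)
    (m : (Fin K → ℝ) → ℝ) (hm : ∀ z, m z = ((1 : Fin K → ℝ) ⬝ᵥ Sig⁻¹.mulVec z) / lam)
    (Ssq : (Fin K → ℝ) → ℝ)
    (hSsq : ∀ z, Ssq z = (1 / (lam * ((K : ℝ) - 1))) *
      ((z - m z • 1) ⬝ᵥ Sig⁻¹.mulVec (z - m z • 1)))
    (R : Set (Fin K → ℝ))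
    (hR : R = {z | tQuantile ((K : ℝ) - 1) (1 - α / 2) * Real.sqrt (Ssq z)
      < |m (z - μ₀ • 1)|}) :
    -- (i) exact size α
    (∀ σ : ℝ, 0 < σ → ∀ P : Measure (Fin K → ℝ),
      IsGaussianVec P (μ₀ • 1) (σ ^ 2 • Sig) → P R = ENNReal.ofReal α) ∧
    -- (ii) uniformly most powerful among unbiased level-α tests
    (∀ φ : (Fin K → ℝ) → ℝ, Measurable φ → (∀ z, φ z ∈ Set.Icc (0 : ℝ) 1) →
      (∀ σ : ℝ, 0 < σ → ∀ P : Measure (Fin K → ℝ),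
        IsGaussianVec P (μ₀ • 1) (σ ^ 2 • Sig) → ∫ z, φ z ∂P ≤ α) →
      (∀ μ : ℝ, μ ≠ μ₀ → ∀ σ : ℝ, 0 < σ → ∀ P : Measure (Fin K → ℝ),
        IsGaussianVec P (μ • 1) (σ ^ 2 • Sig) → α ≤ ∫ z, φ z ∂P) →
      ∀ μ : ℝ, ∀ σ : ℝ, 0 < σ → ∀ P : Measure (Fin K → ℝ),
        IsGaussianVec P (μ • 1) (σ ^ 2 • Sig) →
        ∫ z, φ z ∂P ≤ (P R).toReal) := by

  obtain ⟨n, rfl⟩ : ∃ n, K = n + 1 := ⟨K - 1, by omega⟩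
  have hn : 1 ≤ n := by omega
  have hn' : (0 : ℝ) < n := by exact_mod_cast hn
  have hK1 : ((n + 1 : ℕ) : ℝ) - 1 = n := by push_cast; ring
  rw [hK1] at hR
  simp_rw [hK1] at hSsq
  obtain ⟨ht0, -⟩ := aux_t_two hn hα
  have hsize := aux_size hn hα
  set t := tQuantile n (1 - α / 2) with ht
  set γ := stdGaussianPi (n + 1) with hγ
  -- membership in the region in canonical coordinates
  have hmem : ∀ (B : Matrix (Fin (n + 1)) (Fin (n + 1)) ℝ) (s σ : ℝ), 0 < s → 0 < σ →
      B *ᵥ (Pi.single 0 s) = 1 →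
      (∀ x y, (B *ᵥ y) ⬝ᵥ (Sig⁻¹ *ᵥ (B *ᵥ x)) = σ ^ 2 * (y ⬝ᵥ x)) →
      ∀ x, (μ₀ • 1 + B *ᵥ x ∈ R ↔ t * √((∑ j : Fin n, x j.succ ^ 2) / n) < |x 0|) := by
    intro B s σ hs hσ hB1 hform x
    have hlam' : lam = σ ^ 2 * s ^ 2 := by
      rw [hlam, ← hB1, hform]; simp [sq]
    have hmB : ∀ w, m (B *ᵥ w) = w 0 / s := fun w => by
      rw [hm, ← hB1, hform, hlam']
      simp
      field_simp
    have hz : μ₀ • 1 + B *ᵥ x = B *ᵥ (x + Pi.single 0 (μ₀ * s)) := by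
      have : (Pi.single 0 (μ₀ * s) : Fin (n + 1) → ℝ) = μ₀ • Pi.single 0 s := by
        ext i; simp [Pi.single_apply]
      rw [mulVec_add, this, mulVec_smul, hB1]
      exact add_comm _ _
    have hres : ∀ w, B *ᵥ w - m (B *ᵥ w) • 1 = B *ᵥ (w - Pi.single 0 (w 0)) := fun w => by
      have : (Pi.single 0 (w 0) : Fin (n + 1) → ℝ) = (w 0 / s) • Pi.single 0 s := by
        ext i; simp [Pi.single_apply, hs.ne']
      rw [hmB, mulVec_sub, this, mulVec_smul, hB1]
    have hS : Ssq (μ₀ • 1 + B *ᵥ x) = ((∑ j : Fin n, x j.succ ^ 2) / n) / s ^ 2 := by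
      rw [hSsq, hz, hres, hform, ← sqn_eq_dot, hlam']
      have : sqn (x + Pi.single 0 (μ₀ * s) - Pi.single 0 ((x + Pi.single 0 (μ₀ * s) : Fin (n + 1) → ℝ) 0)) =
          ∑ j : Fin n, x j.succ ^ 2 := by
        simp [sqn, Fin.sum_univ_succ]
      rw [this]
      field_simp
    rw [hR, Set.mem_ofPred_eq, hS, add_sub_cancel_left, hmB, abs_div, abs_of_pos hs,
      Real.sqrt_div' _ (by positivity), Real.sqrt_sq hs.le, mul_div_assoc', div_lt_div_iff_of_pos_right hs]
  have hRmeas : MeasurableSet R := by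
    have h1 : Measurable m := by
      rw [show m = fun z => _ from funext hm]
      simp only [dotProduct, mulVec]
      fun_prop
    have h2 : Measurable Ssq := by
      rw [show Ssq = fun z => _ from funext hSsq]
      simp only [dotProduct, mulVec]
      fun_prop
    rw [hR]
    exact measurableSet_lt (by fun_prop) (by fun_prop)
  refine ⟨?_, ?_⟩
  · rintro σ hσ P ⟨A, hA, rfl⟩
    obtain ⟨B, s, hs, -, hB1, hform, hlaw⟩ := aux_frame hSig hσ hA
    have h := hlaw (μ₀ • 1)
    rw [h, Measure.map_apply (by fun_prop) hRmeas, ← hsize]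
    congr 1
    ext x
    exact hmem B s σ hs hσ hB1 hform x
  · rintro φ hφ hφ01 h0 h1 μ σ hσ P ⟨A, hA, rfl⟩
    obtain ⟨B, s, hs, hBB, hB1, hform, hlaw⟩ := aux_frame hSig hσ hA
    have hshift : ∀ θ : ℝ, B *ᵥ (Pi.single 0 θ) = (θ / s) • 1 := fun θ => by
      have : (Pi.single 0 θ : Fin (n + 1) → ℝ) = (θ / s) • Pi.single 0 s := by
        ext i; simp [Pi.single_apply, hs.ne']
      rw [this, mulVec_smul, hB1]
    have hgv : ∀ τ : ℝ, ∀ θ : ℝ, IsGaussianVec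
        (γ.map (fun x => (μ₀ + θ / s) • (1 : Fin (n + 1) → ℝ) + (τ • B) *ᵥ x))
        ((μ₀ + θ / s) • 1) ((τ * σ) ^ 2 • Sig) := fun τ θ => by
      refine ⟨τ • B, ?_, rfl⟩
      rw [transpose_smul, Matrix.smul_mul, Matrix.mul_smul, ← hBB, smul_smul, smul_smul]
      congr 1; ring
    have hpt : ∀ τ θ : ℝ, ∀ x : Fin (n + 1) → ℝ,
        (μ₀ + θ / s) • (1 : Fin (n + 1) → ℝ) + (τ • B) *ᵥ x =
          μ₀ • 1 + B *ᵥ (τ • x + Pi.single 0 θ) := fun τ θ x => by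
      rw [mulVec_add, hshift, mulVec_smul, smul_mulVec, add_smul]; abel
    have hint : ∀ τ θ : ℝ, ∫ z, φ z ∂(γ.map
        (fun x => (μ₀ + θ / s) • (1 : Fin (n + 1) → ℝ) + (τ • B) *ᵥ x)) =
        ∫ x, φ (μ₀ • 1 + B *ᵥ (τ • x + Pi.single 0 θ)) ∂γ := fun τ θ => by
      rw [integral_map (by fun_prop) hφ.aestronglyMeasurable]
      simp_rw [hpt]
    set c := t / √(n + t ^ 2) with hc
    have hrt : 0 < √(n + t ^ 2) := by positivity
    have hc0 : 0 < c := by positivity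
    have hc1 : c ≤ 1 := by
      rw [hc, div_le_one hrt]
      exact Real.le_sqrt_of_sq_le (by linarith)
    have hset : {x : Fin (n + 1) → ℝ | t * √((∑ j : Fin n, x j.succ ^ 2) / n) < |x 0|} =
        {x | c * √(sqn x) < |x 0|} := by
      ext x; exact aux_region hn ht0 x
    have hEm : MeasurableSet {x : Fin (n + 1) → ℝ | c * √(sqn x) < |x 0|} := by
      have := @measurable_sqn (n + 1)
      exact measurableSet_lt (by fun_prop) (by fun_prop)
    have main := aux_umpu (n := n) hc0 hc1 (α := α) (φ := fun x => φ (μ₀ • 1 + B *ᵥ x))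
      (ψ := Set.indicator {x | c * √(sqn x) < |x 0|} 1)
      (by fun_prop) (fun x => hφ01 _) rfl
      (by
        rw [integral_indicator_one hEm, ← hset, measureReal_def, hsize,
          ENNReal.toReal_ofReal hα.1.le])
      (fun τ hτ => by
        have h := hint τ 0
        have h2 := h0 (τ * σ) (by positivity) _ (by simpa using hgv τ 0)
        simp only [zero_div, add_zero, Pi.single_zero] at h
        rw [← h]; exact h2)
      (fun θ hθ τ hτ => by
        have h := hint τ θ
        have h2 := h1 (μ₀ + θ / s) (by simpa using ⟨hθ, hs.ne'⟩) (τ * σ) (by positivity) _ (hgv τ θ)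
        rw [← h]; exact h2)
      ((μ - μ₀) * s)
    have hμ : μ₀ + (μ - μ₀) * s / s = μ := by field_simp; ring
    have hpt1 : ∀ x, μ • (1 : Fin (n + 1) → ℝ) + B *ᵥ x =
        μ₀ • 1 + B *ᵥ (x + Pi.single 0 ((μ - μ₀) * s)) := fun x => by
      have := hpt 1 ((μ - μ₀) * s) x
      rwa [hμ, one_smul, one_smul] at this
    have hl := hlaw (μ • 1)
    rw [hl, integral_map (by fun_prop) hφ.aestronglyMeasurable,
      Measure.map_apply (by fun_prop) hRmeas]
    simp_rw [hpt1]
    refine main.trans (le_of_eq ?_)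
    have hpre : MeasurableSet ((fun x : Fin (n + 1) → ℝ => x + Pi.single 0 ((μ - μ₀) * s)) ⁻¹'
        {x | c * √(sqn x) < |x 0|}) := (by fun_prop : Measurable
        (fun x : Fin (n + 1) → ℝ => x + Pi.single 0 ((μ - μ₀) * s))) hEm
    have hfin := integral_indicator_one (μ := γ) hpre
    have hcg : ∫ x, Set.indicator {x : Fin (n + 1) → ℝ | c * √(sqn x) < |x 0|} (1 : (Fin (n + 1) → ℝ) → ℝ)
        (x + Pi.single 0 ((μ - μ₀) * s)) ∂γ = ∫ x, Set.indicator
        ((fun x : Fin (n + 1) → ℝ => x + Pi.single 0 ((μ - μ₀) * s)) ⁻¹'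
        {x | c * √(sqn x) < |x 0|}) (1 : (Fin (n + 1) → ℝ) → ℝ) x ∂γ := rfl
    rw [hcg, hfin, measureReal_def]
    congr 2
    ext x
    rw [← hset]
    exact (hmem B s σ hs hσ hB1 hform _).symm
end

section
/- Let K ≥ 2, α ∈ (0,1), ψ ∈ ℝ, and let (Y_n)_{n≥1} be ℝ^K-valued random vectors such that √n(Y_n − ψ1_K) converges in distribution to N(0, s²I_K) for some s > 0 (as holds for equal-size non-overlapping batch estimates of a functional satisfying a central limit theorem). Define the standard batching interval CI_B(y) = [ȳ − t_{K−1,1−α/2}S(y)/√K, ȳ + t_{K−1,1−α/2}S(y)/√K] where ȳ = (1/K)Σ_j y_j and S(y)² = (1/(K−1))Σ_j (y_j − ȳ)². Then: (i) for every δ ∈ ℝ, lim_n P(ψ + n^{−1/2}δ ∈ CI_B(Y_n)) exists, this limit equals 1−α at δ = 0, and is at most 1−α for δ ≠ 0; (ii) for every homogeneous pair (L,U) that is asymptotically unbiased at level 1−α for ψ with respect to (Y_n), and every δ ≠ 0, limsup_n P(L(Y_n) ≤ ψ + n^{−1/2}δ ≤ U(Y_n)) ≥ lim_n P(ψ + n^{−1/2}δ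 ∈ CI_B(Y_n)). That is, standard batching is asymptotically uniformly most accurate unbiased among homogeneous confidence intervals. -/
open MeasureTheory ProbabilityTheory Matrix Filter Topology

/-- A pair of interval-endpoint functions is *homogeneous* if it is positively scale-equivariant,
translation-equivariant along the all-ones direction, and continuous. -/
def Homogeneous {K : ℕ} (L U : (Fin K → ℝ) → ℝ) : Prop :=
  (∀ c : ℝ, 0 < c → ∀ x : Fin K → ℝ, L (c • x) = c * L x ∧ U (c • x) = c * U x) ∧
  (∀ c : ℝ, ∀ x : Fin K → ℝ, L (x + c • 1) = L x + c ∧ U (x + c • 1) = U x + c) ∧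
  Continuous L ∧ Continuous U

/-- `(L, U)` is asymptotically unbiased at level `1 - α` for `ψ` with respect to `Y`:
the coverage of `ψ` tends to a limit `≥ 1 - α`, and the coverage of every local alternative
`ψ + δ/√n`, `δ ≠ 0`, has limsup `≤ 1 - α`. -/
def AsympUnbiased {Ω : Type*} [MeasurableSpace Ω] (P : Measure Ω) {K : ℕ}
    (Y : ℕ → Ω → Fin K → ℝ) (ψ α : ℝ) (L U : (Fin K → ℝ) → ℝ) : Prop :=
  (∃ ℓ : ℝ, 1 - α ≤ ℓ ∧
    Tendsto (fun n => (P {ω | L (Y n ω) ≤ ψ ∧ ψ ≤ U (Y n ω)}).toReal) atTop (𝓝 ℓ)) ∧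
  (∀ δ : ℝ, δ ≠ 0 →
    limsup (fun n => (P {ω | L (Y n ω) ≤ ψ + δ / Real.sqrt n ∧
      ψ + δ / Real.sqrt n ≤ U (Y n ω)}).toReal) atTop ≤ 1 - α)

section Abstract
set_option linter.unusedSectionVars false
variable {E : Type*} [NormedAddCommGroup E] [InnerProductSpace ℝ E] [FiniteDimensional ℝ E]
  [MeasurableSpace E] [BorelSpace E]

/-- Gaussian density. -/
noncomputable def gdens (E : Type*) [NormedAddCommGroup E] [InnerProductSpace ℝ E] (r : ℝ) : ℝ :=
  ((2 * Real.pi) ^ (Module.finrank ℝ E / 2 : ℝ))⁻¹ * Real.exp (-(1 / 2) * r ^ 2)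

lemma gdens_pos (r : ℝ) : 0 < gdens E r := by
  unfold gdens; positivity

lemma gdens_meas : Measurable (gdens E) := by
  unfold gdens; fun_prop

lemma gdens_cont : Continuous (gdens E) := by
  unfold gdens; fun_prop

lemma gdens_integral : ∫ x : E, gdens E ‖x‖ = 1 := by
  unfold gdens
  rw [integral_const_mul, GaussianFourier.integral_rexp_neg_mul_sq_norm (by norm_num)]
  have : Real.pi / (1 / 2) = 2 * Real.pi := by ring
  rw [this]
  exact inv_mul_cancel₀ (by positivity)

lemma gdens_integrable : Integrable (fun x : E => gdens E ‖x‖) := by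
  by_contra h
  have := integral_undef h
  rw [gdens_integral] at this
  norm_num at this

lemma stdGaussian_eq :
    stdGaussian E = (volume : Measure E).withDensity (fun x => ENNReal.ofReal (gdens E ‖x‖)) := by
  have hfin : IsFiniteMeasure
      ((volume : Measure E).withDensity (fun x => ENNReal.ofReal (gdens E ‖x‖))) :=
    isFiniteMeasure_withDensity_ofReal gdens_integrable.2
  apply Measure.ext_of_charFun
  ext t
  rw [charFun_stdGaussian, charFun_apply,
    integral_withDensity_eq_integral_toReal_smul (by have := gdens_meas (E := E); fun_prop) (by simp)]
  simp_rw [ENNReal.toReal_ofReal (gdens_pos _).le]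
  have h := GaussianFourier.integral_cexp_neg_mul_sq_norm_add (V := E) (b := 1/2) (by norm_num)
    Complex.I t
  have h2 : ∀ v : E, gdens E ‖v‖ • Complex.exp ((inner ℝ v t : ℝ) * Complex.I) =
     (((2 * Real.pi) ^ (Module.finrank ℝ E / 2 : ℝ))⁻¹ : ℝ) *
       Complex.exp (-(1/2) * ‖v‖ ^ 2 + Complex.I * (inner ℝ t v : ℝ)) := by
    intro v
    rw [Complex.exp_add]
    simp only [gdens, Complex.real_smul, real_inner_comm t v]
    push_cast
    rw [mul_comm Complex.I]
    ring
  simp_rw [h2]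
  rw [integral_const_mul, h]
  have h3 : ((Real.pi : ℂ) / (1/2)) ^ (Module.finrank ℝ E / 2 : ℂ) =
     (((2 * Real.pi) ^ (Module.finrank ℝ E / 2 : ℝ) : ℝ) : ℂ) := by
    rw [Complex.ofReal_cpow (by positivity)]
    push_cast
    congr 1
    ring
  rw [h3, ← mul_assoc, ← Complex.ofReal_mul, inv_mul_cancel₀ (by positivity)]
  simp only [Complex.I_sq, Complex.ofReal_one, one_mul]
  congr 1
  ring

lemma integral_std (f : E → ℝ) :
    ∫ x, f x ∂(stdGaussian E) = ∫ x, gdens E ‖x‖ * f x := by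
  rw [stdGaussian_eq, integral_withDensity_eq_integral_toReal_smul
    (by have := gdens_meas (E := E); fun_prop) (by simp)]
  simp_rw [ENNReal.toReal_ofReal (gdens_pos _).le, smul_eq_mul]

lemma integral_polar [Nontrivial E] (k : E → ℝ) (hk : ∀ c : ℝ, 0 < c → ∀ x, k (c • x) = k x)
    (ρ : ℝ → ℝ) :
    ∫ x : E, k x * ρ ‖x‖ =
      (∫ y, k (y : E) ∂((volume : Measure E).toSphere)) *
        ∫ r : Set.Ioi (0:ℝ), ρ r ∂(Measure.volumeIoiPow (Module.finrank ℝ E - 1)) := by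
  calc
    ∫ x, k x * ρ ‖x‖ = ∫ x : ({(0)}ᶜ : Set E), k x.1 * ρ (‖x.1‖) ∂((volume : Measure E).comap (↑)) := by
      rw [integral_subtype_comap (measurableSet_singleton _).compl fun x ↦ k x * ρ (‖x‖),
        restrict_compl_singleton]
    _ = ∫ x, k (x.1 : E) * ρ x.2 ∂(volume : Measure E).toSphere.prod (.volumeIoiPow (Module.finrank ℝ E - 1)) := by
      have := (volume : Measure E).measurePreserving_homeomorphUnitSphereProd.integral_comp
        (Homeomorph.measurableEmbedding _) (fun x => k (x.1 : E) * ρ x.2)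
      rw [← this]
      refine integral_congr_ae (ae_of_all _ fun x => ?_)
      simp only [homeomorphUnitSphereProd_apply_snd_coe, homeomorphUnitSphereProd_apply_fst_coe]
      rw [hk]
      exact inv_pos.2 (norm_pos_iff.2 x.2)
    _ = _ := integral_prod_mul (fun y : Metric.sphere (0:E) 1 => k (y:E)) (fun r : Set.Ioi (0:ℝ) => ρ r)

lemma polar_zero [Nontrivial E] (k : E → ℝ) (hk : ∀ c : ℝ, 0 < c → ∀ x, k (c • x) = k x)
    (ρ₁ ρ : ℝ → ℝ) (h1 : 0 < ∫ x : E, ρ₁ ‖x‖ ∂(stdGaussian E))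
    (h0 : ∫ x : E, k x * ρ₁ ‖x‖ ∂(stdGaussian E) = 0) :
    ∫ x : E, k x * ρ ‖x‖ ∂(stdGaussian E) = 0 := by
  rw [integral_std] at h1 h0 ⊢
  have e : ∀ ρ : ℝ → ℝ, ∫ x : E, gdens E ‖x‖ * (k x * ρ ‖x‖) =
      ∫ x : E, k x * (fun r => gdens E r * ρ r) ‖x‖ := by
    intro ρ; congr 1; ext x; ring
  rw [e, integral_polar k hk (fun r => gdens E r * ρ₁ r)] at h0
  rw [e, integral_polar k hk (fun r => gdens E r * ρ r)]
  have h1' : ∫ x : E, gdens E ‖x‖ * ρ₁ ‖x‖ = ∫ x : E, (1:ℝ) * (fun r => gdens E r * ρ₁ r) ‖x‖ := by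
    simp
  rw [h1', integral_polar (fun _ => 1) (by simp) (fun r => gdens E r * ρ₁ r)] at h1
  rcases mul_eq_zero.1 h0 with h | h
  · rw [h, zero_mul]
  · rw [h, mul_zero] at h1
    exact absurd h1 (lt_irrefl _)

lemma integrable_exp_norm (a : ℝ) : Integrable (fun x : E => Real.exp (a * ‖x‖)) (stdGaussian E) := by
  obtain ⟨C, hC, hi⟩ := IsGaussian.exists_integrable_exp_sq (stdGaussian E)
  refine Integrable.mono' (hi.const_mul (Real.exp (a^2 / (4 * C)))) (by fun_prop) (ae_of_all _ fun x => ?_)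
  rw [Real.norm_eq_abs, abs_of_pos (Real.exp_pos _), ← Real.exp_add]
  apply Real.exp_le_exp.2
  have : a^2/(4*C) + C * ‖x‖^2 - a * ‖x‖ = (a - 2 * C * ‖x‖)^2 / (4 * C) := by
    field_simp; ring
  have : 0 ≤ (a - 2 * C * ‖x‖)^2 / (4 * C) := by positivity
  linarith

lemma integrable_exp_inner (u : E) (t : ℝ) :
    Integrable (fun x : E => Real.exp (t * inner ℝ u x)) (stdGaussian E) := by
  refine Integrable.mono' (integrable_exp_norm (E := E) (|t| * ‖u‖)) (by fun_prop)
    (ae_of_all _ fun x => ?_)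
  rw [Real.norm_eq_abs, abs_of_pos (Real.exp_pos _)]
  apply Real.exp_le_exp.2
  calc t * inner ℝ u x ≤ |t * inner ℝ u x| := le_abs_self _
    _ = |t| * |inner ℝ u x| := abs_mul _ _
    _ ≤ |t| * (‖u‖ * ‖x‖) := by gcongr; exact abs_real_inner_le_norm u x
    _ = _ := by ring

lemma integrable_norm_std : Integrable (fun x : E => ‖x‖) (stdGaussian E) := by
  refine Integrable.mono' (integrable_exp_norm (E := E) 1) (by fun_prop)
    (ae_of_all _ fun x => ?_)
  rw [norm_norm, one_mul]
  linarith [Real.add_one_le_exp ‖x‖]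

lemma integral_norm_pos [Nontrivial E] : 0 < ∫ x : E, ‖x‖ ∂(stdGaussian E) := by
  rw [integral_std]
  have hi : Integrable (fun x : E => gdens E ‖x‖ * ‖x‖) := by
    have h := integrable_norm_std (E := E)
    rw [stdGaussian_eq, integrable_withDensity_iff_integrable_smul' (by have := gdens_meas (E := E); fun_prop) (by simp)] at h
    simpa [ENNReal.toReal_ofReal (gdens_pos _).le] using h
  obtain ⟨v, hv⟩ := exists_ne (0 : E)
  refine (integral_pos_iff_support_of_nonneg (fun x => mul_nonneg (gdens_pos _).le (norm_nonneg _)) hi).2 ?_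
  have hc : Continuous (fun x : E => gdens E ‖x‖ * ‖x‖) := by
    have := gdens_cont (E := E); fun_prop
  refine (hc.isOpen_support).measure_pos _ ⟨v, ?_⟩
  simp [hv, (gdens_pos _).ne']

end Abstract

section Abstract2
set_option linter.unusedSectionVars false
variable {E : Type*} [NormedAddCommGroup E] [InnerProductSpace ℝ E] [FiniteDimensional ℝ E]
  [MeasurableSpace E] [BorelSpace E]

lemma exp_ge_secant_aux {v : ℝ} (hv : 1 ≤ v) (y : ℝ) :
    Real.cosh y + v * Real.sinh y ≤ Real.exp (y * v) := by
  have hc := convexOn_exp.2 (Set.mem_univ (y * v)) (Set.mem_univ (-y))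
    (show 0 ≤ 2 / (1 + v) by positivity) (show 0 ≤ (v - 1) / (1 + v) by
      apply div_nonneg <;> linarith) (by field_simp; ring)
  have e : (2 / (1 + v)) • (y * v) + ((v - 1) / (1 + v)) • (-y) = y := by
    simp only [smul_eq_mul]; field_simp; ring
  rw [e, smul_eq_mul, smul_eq_mul] at hc
  have hc2 : (1 + v) * Real.exp y ≤ 2 * Real.exp (y * v) + (v - 1) * Real.exp (-y) := by
    have := mul_le_mul_of_nonneg_left hc (show 0 ≤ 1 + v by linarith)
    refine this.trans (le_of_eq ?_)
    field_simp
  rw [Real.cosh_eq, Real.sinh_eq]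
  linarith

lemma exp_ge_secant {v : ℝ} (hv : 1 ≤ |v|) (y : ℝ) :
    Real.cosh y + v * Real.sinh y ≤ Real.exp (y * v) := by
  rcases le_abs.1 hv with h | h
  · exact exp_ge_secant_aux h y
  · have := exp_ge_secant_aux h (-y)
    simpa using this

lemma exp_le_secant {v : ℝ} (hv : |v| ≤ 1) (y : ℝ) :
    Real.exp (y * v) ≤ Real.cosh y + v * Real.sinh y := by
  have := abs_le.1 hv
  have hc := convexOn_exp.2 (Set.mem_univ y) (Set.mem_univ (-y))
    (show 0 ≤ (1 + v) / 2 by linarith) (show 0 ≤ (1 - v) / 2 by linarith) (by ring)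
  have e : ((1 + v) / 2) • y + ((1 - v) / 2) • (-y) = y * v := by
    simp only [smul_eq_mul]; ring
  rw [e, smul_eq_mul, smul_eq_mul] at hc
  rw [Real.cosh_eq, Real.sinh_eq]
  linarith

/-- The acceptance cone of the t test. -/
def tcone (u : E) (c : ℝ) : Set E := {x | |inner ℝ u x| ≤ c * ‖x‖}

lemma tcone_meas (u : E) (c : ℝ) : MeasurableSet (tcone u c) :=
  measurableSet_le (by fun_prop) (by fun_prop)

lemma tcone_smul (u : E) (c : ℝ) {a : ℝ} (ha : 0 < a) (x : E) :
    a • x ∈ tcone u c ↔ x ∈ tcone u c := by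
  simp only [tcone, Set.mem_ofPred_eq, inner_smul_right, norm_smul, abs_mul, abs_of_pos ha,
    Real.norm_eq_abs]
  rw [show c * (a * ‖x‖) = a * (c * ‖x‖) by ring]
  exact mul_le_mul_iff_right₀ ha

lemma integral_odd (f : E → ℝ) (hf : ∀ x, f (-x) = - f x) :
    ∫ x, f x ∂(stdGaussian E) = 0 := by
  rw [integral_std]
  have h := integral_neg_eq_self (fun x : E => gdens E ‖x‖ * f x) volume
  simp only [norm_neg, hf, mul_neg] at h
  rw [integral_neg] at h
  linarith

lemma np_lemma [Nontrivial E] (u : E) (c : ℝ) (hc : 0 < c) (h : E → ℝ) (hm : Measurable h)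
    (h0 : ∀ x, 0 ≤ h x) (h1 : ∀ x, h x ≤ 1) (hh : ∀ a : ℝ, 0 < a → ∀ x, h (a • x) = h x)
    (hE : ∫ x, h x ∂(stdGaussian E) = (stdGaussian E).real (tcone u c))
    (hU : ∫ x, h x * inner ℝ u x ∂(stdGaussian E) = 0) (t : ℝ) :
    ∫ x in tcone u c, Real.exp (t * inner ℝ u x) ∂(stdGaussian E) ≤
      ∫ x, h x * Real.exp (t * inner ℝ u x) ∂(stdGaussian E) := by
  classical
  set B := tcone u c with hB
  have hBm : MeasurableSet B := tcone_meas u c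
  set b : E → ℝ := B.indicator 1 with hb
  have hbm : Measurable b := measurable_one.indicator hBm
  have hb01 : ∀ x, 0 ≤ b x ∧ b x ≤ 1 := by
    intro x; by_cases hx : x ∈ B <;> simp [hb, hx]
  have hbh : ∀ a : ℝ, 0 < a → ∀ x, b (a • x) = b x := by
    intro a ha x
    simp only [hb, Set.indicator, hB, tcone_smul u c ha]
    rfl
  set k : E → ℝ := fun x => h x - b x with hk
  have hkm : Measurable k := hm.sub hbm
  have hkabs : ∀ x, ‖k x‖ ≤ 1 := by
    intro x
    rw [Real.norm_eq_abs, abs_le]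
    constructor <;> simp only [hk] <;> linarith [h0 x, h1 x, (hb01 x).1, (hb01 x).2]
  have hkh : ∀ a : ℝ, 0 < a → ∀ x, k (a • x) = k x := by
    intro a ha x; simp only [hk, hh a ha, hbh a ha]
  have hkI : ∀ g : E → ℝ, Integrable g (stdGaussian E) →
      Integrable (fun x => k x * g x) (stdGaussian E) := fun g hg =>
    hg.bdd_mul (c := 1) hkm.aestronglyMeasurable (ae_of_all _ hkabs)
  have hhI : ∀ g : E → ℝ, Integrable g (stdGaussian E) →
      Integrable (fun x => h x * g x) (stdGaussian E) := fun g hg =>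
    hg.bdd_mul (c := 1) hm.aestronglyMeasurable (ae_of_all _ fun x => by
      rw [Real.norm_eq_abs, abs_of_nonneg (h0 x)]; exact h1 x)
  have hbI : ∀ g : E → ℝ, Integrable g (stdGaussian E) →
      Integrable (fun x => b x * g x) (stdGaussian E) := fun g hg =>
    hg.bdd_mul (c := 1) hbm.aestronglyMeasurable (ae_of_all _ fun x => by
      rw [Real.norm_eq_abs, abs_of_nonneg (hb01 x).1]; exact (hb01 x).2)
  have hsplit : ∀ g : E → ℝ, Integrable g (stdGaussian E) →
      ∫ x, k x * g x ∂(stdGaussian E) = ∫ x, h x * g x ∂(stdGaussian E) -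
        ∫ x in B, g x ∂(stdGaussian E) := by
    intro g hg
    have e : ∫ x in B, g x ∂(stdGaussian E) = ∫ x, b x * g x ∂(stdGaussian E) := by
      rw [← integral_indicator hBm]
      congr 1; ext x
      by_cases hx : x ∈ B <;> simp [hb, hx]
    rw [e, ← integral_sub (hhI g hg) (hbI g hg)]
    congr 1; ext x; simp only [hk]; ring
  have hinI : Integrable (fun x : E => inner ℝ u x) (stdGaussian E) := by
    refine Integrable.mono' (integrable_norm_std.const_mul ‖u‖) (by fun_prop)
      (ae_of_all _ fun x => abs_real_inner_le_norm u x)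
  have hk0 : ∫ x, k x * (fun _ => (1:ℝ)) ‖x‖ ∂(stdGaussian E) = 0 := by
    rw [hsplit _ (integrable_const _)]
    simp [hE]
  set W : E → ℝ := fun x => inner ℝ u x / ‖x‖ with hW
  have hWx : ∀ x, inner ℝ u x = W x * ‖x‖ := by
    intro x
    by_cases hx : x = 0
    · simp [hx]
    · simp only [hW]
      rw [div_mul_cancel₀ _ (norm_ne_zero_iff.2 hx)]
  have hWb : ∀ x, |W x| ≤ ‖u‖ := by
    intro x
    simp only [hW, abs_div, abs_norm]
    exact div_le_of_le_mul₀ (norm_nonneg _) (norm_nonneg _) (abs_real_inner_le_norm u x)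
  have hWh : ∀ a : ℝ, 0 < a → ∀ x, W (a • x) = W x := by
    intro a ha x
    simp only [hW, inner_smul_right, norm_smul, Real.norm_eq_abs, abs_of_pos ha]
    exact mul_div_mul_left _ _ ha.ne'
  have hWm : Measurable W := by simp only [hW]; fun_prop
  have hk1 : ∫ x, (k x * W x) * (fun r => r) ‖x‖ ∂(stdGaussian E) = 0 := by
    have e : ∀ x : E, (k x * W x) * ‖x‖ = k x * inner ℝ u x := by
      intro x; rw [hWx x]; ring
    simp only [e]
    rw [hsplit _ hinI, hU]
    have : ∫ x in B, inner ℝ u x ∂(stdGaussian E) = 0 := by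
      rw [← integral_indicator hBm]
      apply integral_odd
      intro x
      have hx : -x ∈ B ↔ x ∈ B := by simp [hB, tcone]
      by_cases hxB : x ∈ B
      · simp [hxB, hx.2 hxB]
      · simp [hxB, mt hx.1 hxB]
    rw [this, sub_zero]
  have z0 := polar_zero k hkh (fun _ => 1) (fun r => Real.cosh (t * c * r)) (by simp) hk0
  have z1 := polar_zero (fun x => k x * W x) (fun a ha x => by rw [hkh a ha, hWh a ha]) (fun r => r)
    (fun r => Real.sinh (t * c * r) / c) integral_norm_pos hk1
  have hcosh : Integrable (fun x : E => Real.cosh (t * c * ‖x‖)) (stdGaussian E) := by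
    refine (((integrable_exp_norm (E := E) (t * c)).add
      (integrable_exp_norm (-(t * c)))).div_const 2).congr (ae_of_all _ fun x => ?_)
    simp only [Pi.add_apply, Real.cosh_eq, neg_mul]
  have hsinh : Integrable (fun x : E => Real.sinh (t * c * ‖x‖) / c) (stdGaussian E) := by
    refine ((((integrable_exp_norm (E := E) (t * c)).sub
      (integrable_exp_norm (-(t * c)))).div_const 2).div_const c).congr (ae_of_all _ fun x => ?_)
    simp only [Pi.sub_apply, Real.sinh_eq, neg_mul]
  have hWs : Integrable (fun x : E => W x * (Real.sinh (t * c * ‖x‖) / c)) (stdGaussian E) :=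
    hsinh.bdd_mul (c := ‖u‖) hWm.aestronglyMeasurable (ae_of_all _ hWb)
  have hexp := integrable_exp_inner u t
  have key : 0 ≤ ∫ x, (k x * Real.exp (t * inner ℝ u x) - k x * Real.cosh (t * c * ‖x‖) -
      k x * (W x * (Real.sinh (t * c * ‖x‖) / c))) ∂(stdGaussian E) := by
    apply integral_nonneg
    intro x
    have e1 : t * inner ℝ u x = (t * c * ‖x‖) * (W x / c) := by
      rw [hWx x]; field_simp
    have e2 : k x * Real.exp (t * inner ℝ u x) - k x * Real.cosh (t * c * ‖x‖) -
      k x * (W x * (Real.sinh (t * c * ‖x‖) / c)) =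
      k x * (Real.exp ((t * c * ‖x‖) * (W x / c)) -
        (Real.cosh (t * c * ‖x‖) + (W x / c) * Real.sinh (t * c * ‖x‖))) := by
      rw [e1]; ring
    simp only [Pi.zero_apply]
    rw [e2]
    by_cases hx : x ∈ B
    · have hv : |W x / c| ≤ 1 := by
        rw [abs_div, abs_of_pos hc, div_le_one hc]
        simp only [hW, abs_div, abs_norm]
        exact div_le_of_le_mul₀ (norm_nonneg _) hc.le hx
      have hkx : k x ≤ 0 := by simp [hk, hb, hx, h1 x]
      exact mul_nonneg_of_nonpos_of_nonpos hkx (by linarith [exp_le_secant hv (t * c * ‖x‖)])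
    · have hx' : c * ‖x‖ < |inner ℝ u x| := not_le.1 hx
      have hx0 : 0 < ‖x‖ := by
        rcases (norm_nonneg x).eq_or_lt with h | h
        · exfalso
          have : x = 0 := norm_eq_zero.1 h.symm
          simp [this] at hx'
        · exact h
      have hv : 1 ≤ |W x / c| := by
        rw [abs_div, abs_of_pos hc, one_le_div hc]
        simp only [hW, abs_div, abs_norm]
        rw [le_div_iff₀ hx0]
        exact hx'.le
      have hkx : 0 ≤ k x := by simp [hk, hb, hx, h0 x]
      exact mul_nonneg hkx (by linarith [exp_ge_secant hv (t * c * ‖x‖)])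
  have hsub : Integrable (fun x => k x * Real.exp (t * inner ℝ u x) -
      k x * Real.cosh (t * c * ‖x‖)) (stdGaussian E) := (hkI _ hexp).sub (hkI _ hcosh)
  rw [integral_sub hsub (hkI _ hWs), integral_sub (hkI _ hexp) (hkI _ hcosh),
    z0, hsplit _ hexp] at key
  have z1' : ∫ x, k x * (W x * (Real.sinh (t * c * ‖x‖) / c)) ∂(stdGaussian E) = 0 := by
    rw [← z1]; congr 1; ext x; ring
  rw [z1'] at key
  linarith

/-- shifted coverage -/
lemma shift_real (A : Set E) (hA : MeasurableSet A) (v : E) :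
    (stdGaussian E).real {z | z - v ∈ A} =
      Real.exp (-‖v‖ ^ 2 / 2) * ∫ x in A, Real.exp (- inner ℝ v x) ∂(stdGaussian E) := by
  have hm : MeasurableSet {z : E | z - v ∈ A} := (measurable_sub_const v) hA
  rw [← integral_indicator_one hm, integral_std, ← integral_indicator hA, integral_std,
    ← integral_const_mul, ← integral_add_right_eq_self _ v]
  congr 1; ext x
  by_cases hx : x ∈ A
  · have hx' : x + v ∈ {z : E | z - v ∈ A} := by simpa using hx
    simp only [hx, hx', Set.indicator_of_mem, Pi.one_apply, mul_one]
    simp only [gdens]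
    rw [norm_add_sq_real, mul_assoc, ← Real.exp_add, mul_left_comm, ← Real.exp_add]
    congr 2
    rw [real_inner_comm v x]
    ring
  · have hx' : x + v ∉ {z : E | z - v ∈ A} := by simpa using hx
    simp [hx, hx']

end Abstract2

section Abstract3
set_option linter.unusedSectionVars false
variable {E : Type*} [NormedAddCommGroup E] [InnerProductSpace ℝ E] [FiniteDimensional ℝ E]
  [MeasurableSpace E] [BorelSpace E]

/-- coverage of the alternative `m` by the cone `A` -/
noncomputable def gcov (u : E) (A : Set E) (m : ℝ) : ℝ :=
  (stdGaussian E).real {z | z - m • u ∈ A}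

lemma gcov_zero (u : E) (A : Set E) : gcov u A 0 = (stdGaussian E).real A := by
  simp [gcov]

lemma gcov_eq (u : E) (A : Set E) (hA : MeasurableSet A) (m : ℝ) :
    gcov u A m = Real.exp (-(m ^ 2 * ‖u‖ ^ 2) / 2) *
      ∫ x in A, Real.exp (-m * inner ℝ u x) ∂(stdGaussian E) := by
  rw [gcov, shift_real A hA]
  simp only [norm_smul, mul_pow, Real.norm_eq_abs, sq_abs, inner_smul_left, neg_mul]
  rfl

lemma gcov_hasDerivAt (u : E) (A : Set E) (hA : MeasurableSet A) :
    HasDerivAt (gcov u A) (- ∫ x in A, inner ℝ u x ∂(stdGaussian E)) 0 := by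
  have hset : integrableExpSet (fun x : E => inner ℝ u x) ((stdGaussian E).restrict A) = Set.univ := by
    ext t
    simp only [Set.mem_univ, iff_true]
    exact (integrable_exp_inner u t).restrict
  have h1 := hasDerivAt_mgf (X := fun x : E => inner ℝ u x) (μ := (stdGaussian E).restrict A)
    (t := -0) (by rw [hset]; simp)
  have h2 : HasDerivAt (fun m : ℝ => mgf (fun x : E => inner ℝ u x) ((stdGaussian E).restrict A) (-m))
    _ 0 := h1.comp (0:ℝ) (hasDerivAt_neg (0:ℝ))
  have h3 : HasDerivAt (fun m : ℝ => Real.exp (-(m ^ 2 * ‖u‖ ^ 2) / 2)) 0 0 := by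
    have := ((((hasDerivAt_id (0:ℝ)).pow 2).mul_const (‖u‖^2)).neg.div_const 2).exp
    simpa using this
  have h4 := h3.mul h2
  have e : gcov u A = fun m => Real.exp (-(m ^ 2 * ‖u‖ ^ 2) / 2) *
      mgf (fun x : E => inner ℝ u x) ((stdGaussian E).restrict A) (-m) := by
    ext m; rw [gcov_eq u A hA]; rfl
  rw [e]
  refine HasDerivAt.congr_deriv h4 ?_
  simp

theorem gcov_compare [Nontrivial E] (u : E) (c : ℝ) (hc : 0 < c) (A : Set E) (hA : MeasurableSet A)
    (hAh : ∀ a : ℝ, 0 < a → ∀ x, a • x ∈ A ↔ x ∈ A)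
    (h0 : gcov u (tcone u c) 0 ≤ gcov u A 0)
    (h1 : ∀ m, m ≠ 0 → gcov u A m ≤ gcov u (tcone u c) 0) (m : ℝ) :
    gcov u (tcone u c) m ≤ gcov u A m := by
  classical
  have hd := gcov_hasDerivAt u A hA
  have heq : gcov u A 0 = gcov u (tcone u c) 0 := by
    refine le_antisymm ?_ h0
    have ht : Tendsto (gcov u A) (𝓝[≠] 0) (𝓝 (gcov u A 0)) :=
      hd.continuousAt.tendsto.mono_left nhdsWithin_le_nhds
    exact le_of_tendsto ht (eventually_nhdsWithin_of_forall fun m hm => h1 m hm)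
  have hmax : IsLocalMax (gcov u A) 0 := by
    refine Eventually.of_forall fun m => ?_
    by_cases hm : m = 0
    · rw [hm]
    · rw [heq]; exact h1 m hm
  have hz := hmax.hasDerivAt_eq_zero hd
  have hprod : ∀ g : E → ℝ, ∫ x, A.indicator (1 : E → ℝ) x * g x ∂(stdGaussian E) =
      ∫ x in A, g x ∂(stdGaussian E) := by
    intro g
    rw [← integral_indicator hA]
    congr 1; ext x
    by_cases hx : x ∈ A <;> simp [hx]
  have := np_lemma u c hc (A.indicator 1) (measurable_one.indicator hA)
    (fun x => by by_cases hx : x ∈ A <;> simp [hx])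
    (fun x => by by_cases hx : x ∈ A <;> simp [hx])
    (fun a ha x => by simp only [Set.indicator, hAh a ha x]; rfl)
    (by rw [integral_indicator_one hA, ← gcov_zero u A, ← gcov_zero u, heq])
    (by rw [hprod]; linarith) (-m)
  rw [hprod] at this
  rw [gcov_eq u _ (tcone_meas u c), gcov_eq u A hA]
  gcongr

theorem gcov_unbiased [Nontrivial E] (u : E) (c : ℝ) (hc : 0 < c) (m : ℝ) :
    gcov u (tcone u c) m ≤ gcov u (tcone u c) 0 := by
  set p := (stdGaussian E).real (tcone u c) with hp
  have := np_lemma u c hc (fun _ => p) measurable_const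
    (fun x => measureReal_nonneg) (fun x => measureReal_le_one) (fun _ _ _ => rfl)
    (by simp [hp]) (by rw [integral_const_mul, integral_odd _ (fun x => by simp), mul_zero]) (-m)
  rw [integral_const_mul] at this
  have huniv : gcov u (Set.univ : Set E) m = 1 := by simp [gcov]
  rw [gcov_eq u _ MeasurableSet.univ, setIntegral_univ] at huniv
  rw [gcov_zero, gcov_eq u _ (tcone_meas u c), ← hp]
  calc _ ≤ Real.exp (-(m ^ 2 * ‖u‖ ^ 2) / 2) * (p * ∫ x, Real.exp (-m * inner ℝ u x) ∂(stdGaussian E)) := by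
        gcongr
    _ = p * (Real.exp (-(m ^ 2 * ‖u‖ ^ 2) / 2) * ∫ x, Real.exp (-m * inner ℝ u x) ∂(stdGaussian E)) := by ring
    _ = p := by rw [huniv, mul_one]

end Abstract3

section Abstract4
set_option linter.unusedSectionVars false
variable {E : Type*} [NormedAddCommGroup E] [InnerProductSpace ℝ E] [FiniteDimensional ℝ E]
  [MeasurableSpace E] [BorelSpace E]

lemma gamma_real_eq {a : ℝ} (ha : 0 < a) (s : Set ℝ) (hs : MeasurableSet s) :
    (gammaMeasure a (1 / 2)).real s =
      ∫ y in Set.Ioi (0:ℝ), (2 * y) * (gammaPDFReal a (1 / 2) (y ^ 2) * s.indicator 1 (y ^ 2)) := by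
  have h1 : (gammaMeasure a (1 / 2)).real s =
      ∫ x, gammaPDFReal a (1 / 2) x * s.indicator (1 : ℝ → ℝ) x := by
    rw [← integral_indicator_one hs, gammaMeasure,
      integral_withDensity_eq_integral_toReal_smul
      (by unfold gammaPDF; fun_prop) (by simp [gammaPDF])]
    refine integral_congr_ae (ae_of_all _ fun x => ?_)
    simp only [gammaPDF, smul_eq_mul]
    rw [ENNReal.toReal_ofReal (gammaPDFReal_nonneg ha (by norm_num) x)]
  have h2 : ∫ x, gammaPDFReal a (1 / 2) x * s.indicator (1 : ℝ → ℝ) x =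
      ∫ x in Set.Ici (0:ℝ), gammaPDFReal a (1 / 2) x * s.indicator (1 : ℝ → ℝ) x := by
    rw [setIntegral_eq_integral_of_forall_compl_eq_zero]
    intro x hx
    have : ¬ (0 ≤ x) := hx
    simp [gammaPDFReal, this]
  rw [h1, h2, integral_Ici_eq_integral_Ioi, ← integral_comp_rpow_Ioi_of_pos (p := 2) (by norm_num)]
  refine setIntegral_congr_fun measurableSet_Ioi fun y hy => ?_
  have e : (2:ℝ) - 1 = 1 := by norm_num
  simp only [e, Real.rpow_one, smul_eq_mul, Real.rpow_two]

lemma chi2_real [Nontrivial E] : ∃ C : ℝ, ∀ s : Set ℝ, MeasurableSet s →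
    (stdGaussian E).real ((fun x => ‖x‖ ^ 2) ⁻¹' s) =
      C * (gammaMeasure (Module.finrank ℝ E / 2) (1 / 2)).real s := by
  have hn : 0 < Module.finrank ℝ E := Module.finrank_pos
  set n := Module.finrank ℝ E with hnn
  have ha : (0:ℝ) < (n : ℝ) / 2 := by positivity
  set k : ℝ := (1 / 2 : ℝ) ^ ((n : ℝ) / 2) / Real.Gamma ((n : ℝ) / 2) with hk
  have hkpos : 0 < k := by
    have := Real.Gamma_pos_of_pos ha
    positivity
  set g : ℝ := ((2 * Real.pi) ^ ((n : ℝ) / 2))⁻¹ with hg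
  refine ⟨n * (volume : Measure E).real (Metric.ball 0 1) * (g / (2 * k)), fun s hs => ?_⟩
  have hm : MeasurableSet ((fun x : E => ‖x‖ ^ 2) ⁻¹' s) := by
    apply MeasurableSet.preimage hs; fun_prop
  rw [← integral_indicator_one hm, integral_std, gamma_real_eq ha s hs]
  have h3 := integral_fun_norm_addHaar (volume : Measure E)
    (fun r => gdens E r * s.indicator (1 : ℝ → ℝ) (r ^ 2))
  have e1 : ∀ x : E, ((fun x : E => ‖x‖ ^ 2) ⁻¹' s).indicator (1 : E → ℝ) x =
      s.indicator (1 : ℝ → ℝ) (‖x‖ ^ 2) := by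
    intro x; rfl
  simp_rw [e1]
  rw [h3, nsmul_eq_mul, smul_eq_mul, mul_assoc _ (g / (2 * k)), ← mul_assoc]
  congr 1
  rw [← integral_const_mul]
  refine setIntegral_congr_fun measurableSet_Ioi fun y hy => ?_
  have hy : (0:ℝ) < y := hy
  simp only [smul_eq_mul, gdens, gammaPDFReal, if_pos (sq_nonneg y), ← hnn, ← hk, ← hg]
  have e2 : (y ^ 2) ^ ((n : ℝ) / 2 - 1) * y = y ^ (n - 1) := by
    rw [← Real.rpow_natCast y 2, ← Real.rpow_mul hy.le, ← Real.rpow_natCast y (n - 1)]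
    nth_rw 2 [← Real.rpow_one y]
    rw [← Real.rpow_add hy]
    congr 1
    rw [Nat.cast_sub hn]
    push_cast
    ring
  rw [← e2]
  field_simp

lemma chi2 [Nontrivial E] :
    (stdGaussian E).map (fun x => ‖x‖ ^ 2) = gammaMeasure (Module.finrank ℝ E / 2) (1 / 2) := by
  have hn : 0 < Module.finrank ℝ E := Module.finrank_pos
  have : IsProbabilityMeasure (gammaMeasure (Module.finrank ℝ E / 2) (1 / 2)) :=
    isProbabilityMeasure_gammaMeasure (by positivity) (by norm_num)
  obtain ⟨C, hC⟩ := chi2_real (E := E)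
  have h1 := hC Set.univ MeasurableSet.univ
  simp only [Set.preimage_univ, probReal_univ, mul_one] at h1
  ext s hs
  rw [Measure.map_apply (by fun_prop) hs]
  have h2 := hC s hs
  rw [← h1, one_mul] at h2
  exact (measureReal_eq_measureReal_iff).1 h2

lemma chi2' (d : ℕ) (hd : 1 ≤ d) :
    (Measure.pi (fun _ : Fin d => gaussianReal 0 1)).map (fun x => ∑ i, x i ^ 2) = chiSq d := by
  have : Nonempty (Fin d) := ⟨⟨0, hd⟩⟩
  have := chi2 (E := EuclideanSpace ℝ (Fin d))
  rw [← map_pi_eq_stdGaussian, Measure.map_map (by fun_prop) (by fun_prop)] at this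
  rw [chiSq]
  simp only [finrank_euclideanSpace, Fintype.card_fin] at this
  rw [← this]
  congr 1
  ext x
  simp [EuclideanSpace.real_norm_sq_eq]

lemma joint_law (d : ℕ) (hd : 1 ≤ d) (hf : Module.finrank ℝ E = d + 1) (e : E) (he : ‖e‖ = 1) :
    (stdGaussian E).map (fun z => (inner ℝ e z, ‖z‖ ^ 2 - (inner ℝ e z) ^ 2)) =
      (gaussianReal 0 1).prod (chiSq d) := by
  obtain ⟨b, hb⟩ := Orthonormal.exists_orthonormalBasis_extension_of_card_eq (𝕜 := ℝ) (E := E)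
    (ι := Fin (d + 1)) (by simpa using hf) (v := fun _ => e) (s := {0}) (by
      rw [orthonormal_iff_ite]
      rintro ⟨i, hi⟩ ⟨j, hj⟩
      simp only [Set.mem_singleton_iff] at hi hj
      subst hi hj
      simp [he])
  have hb0 : b 0 = e := hb 0 rfl
  rw [stdGaussian_eq_map_pi_orthonormalBasis b, Measure.map_map (by fun_prop) (by fun_prop)]
  have hin : ∀ x : Fin (d + 1) → ℝ, inner ℝ e (∑ i, x i • b i) = x 0 := by
    intro x
    rw [← hb0, inner_sum]
    simp [inner_smul_right, b.inner_eq_ite]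
  have hno : ∀ x : Fin (d + 1) → ℝ, ‖∑ i, x i • b i‖ ^ 2 = ∑ i, x i ^ 2 := by
    intro x
    rw [← real_inner_self_eq_norm_sq, sum_inner]
    simp [inner_sum, inner_smul_right, inner_smul_left, b.inner_eq_ite, sq]
  have hfun : ((fun z : E => (inner ℝ e z, ‖z‖ ^ 2 - (inner ℝ e z) ^ 2)) ∘
      fun x : Fin (d + 1) → ℝ => ∑ i, x i • b i) =
      (Prod.map id (fun y : Fin d → ℝ => ∑ i, y i ^ 2)) ∘
        (MeasurableEquiv.piFinSuccAbove (fun _ : Fin (d + 1) => ℝ) 0) := by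
    ext x
    · simp [hin]
    · simp only [Function.comp_apply, hin, hno]
      rw [Fin.sum_univ_succ]
      simp [MeasurableEquiv.piFinSuccAbove, Fin.insertNthEquiv, Fin.tail]
  rw [hfun, ← Measure.map_map (by fun_prop) (by fun_prop),
    (measurePreserving_piFinSuccAbove (fun _ : Fin (d + 1) => gaussianReal 0 1) 0).map_eq,
    ← Measure.map_prod_map _ _ measurable_id (by fun_prop), Measure.map_id]
  rw [chi2' d hd]

end Abstract4

section Quantile
set_option linter.unusedSectionVars false

lemma cdf_continuous_of_noAtoms (T : Measure ℝ) [IsProbabilityMeasure T] (h : ∀ x, T {x} = 0) :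
    Continuous (cdf T) := by
  rw [continuous_iff_continuousAt]
  intro x
  rw [(monotone_cdf T).continuousAt_iff_leftLim_eq_rightLim, (cdf T).rightLim_eq]
  have := StieltjesFunction.measure_singleton (cdf T) x
  rw [measure_cdf, h, eq_comm, ENNReal.ofReal_eq_zero] at this
  exact le_antisymm ((monotone_cdf T).leftLim_le le_rfl) (by linarith)

lemma quantile_symm (T : Measure ℝ) [IsProbabilityMeasure T] (h : ∀ x, T {x} = 0)
    (hsym : T.map (fun x => -x) = T) (p : ℝ) (hp : 1 / 2 < p) (hp1 : p < 1) (t : ℝ)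
    (ht : t = sInf {x : ℝ | p ≤ (T (Set.Iic x)).toReal}) :
    0 < t ∧ T.real (Set.Icc (-t) t) = 2 * p - 1 := by
  have hF : ∀ x, (T (Set.Iic x)).toReal = cdf T x := fun x => (cdf_eq_real T x).symm
  simp_rw [hF] at ht
  have hcont := cdf_continuous_of_noAtoms T h
  have hclosed : IsClosed {x : ℝ | p ≤ cdf T x} := isClosed_le continuous_const hcont
  have hne : {x : ℝ | p ≤ cdf T x}.Nonempty := by
    obtain ⟨x, hx⟩ := ((tendsto_cdf_atTop T).eventually (lt_mem_nhds hp1)).exists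
    exact ⟨x, hx.le⟩
  have hbdd : BddBelow {x : ℝ | p ≤ cdf T x} := by
    obtain ⟨x, hx⟩ := ((tendsto_cdf_atBot T).eventually
      (gt_mem_nhds (show (0:ℝ) < p by linarith))).exists
    refine ⟨x, fun y hy => ?_⟩
    by_contra hlt
    have h1 := monotone_cdf T (not_le.1 hlt).le
    have h2 : p ≤ cdf T y := hy
    linarith
  have hmem : p ≤ cdf T t := by
    have := hclosed.csInf_mem hne hbdd
    rw [← ht] at this
    exact this
  have hle : cdf T t ≤ p := by
    have h1 : Tendsto (cdf T) (𝓝[<] t) (𝓝 (cdf T t)) := (hcont.tendsto t).mono_left nhdsWithin_le_nhds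
    refine le_of_tendsto h1 ?_
    filter_upwards [self_mem_nhdsWithin] with x hx
    by_contra hlt
    have h2 : t ≤ x := by
      rw [ht]
      exact csInf_le hbdd (not_le.1 hlt).le
    exact absurd hx (not_lt.2 h2)
  have hFt : T.real (Set.Iic t) = p := by rw [← cdf_eq_real]; exact le_antisymm hle hmem
  have hIoi : ∀ x, T.real (Set.Ioi x) = 1 - T.real (Set.Iic x) := by
    intro x
    rw [← Set.compl_Iic, probReal_compl_eq_one_sub measurableSet_Iic]
  have hsymIio : ∀ x, T.real (Set.Iio (-x)) = T.real (Set.Ioi x) := by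
    intro x
    conv_lhs => rw [← hsym]
    rw [map_measureReal_apply (by fun_prop) measurableSet_Iio]
    congr 1
    ext y
    simp
  have hIio : ∀ x, T.real (Set.Iio x) = T.real (Set.Iic x) := by
    intro x
    refine measureReal_congr ?_
    have : NullSingletonClass T := ⟨h⟩
    exact Iio_ae_eq_Iic
  have h0 : T.real (Set.Iic 0) = 1 / 2 := by
    have h1 := hsymIio 0
    rw [neg_zero, hIoi, hIio] at h1
    linarith
  have htpos : 0 < t := by
    by_contra hlt
    have h1 := monotone_cdf T (not_lt.1 hlt)
    rw [cdf_eq_real, cdf_eq_real, hFt, h0] at h1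
    linarith
  refine ⟨htpos, ?_⟩
  have h1 : Set.Icc (-t) t = Set.Iic t \ Set.Iio (-t) := by
    ext x; simp [and_comm]
  rw [h1, measureReal_sdiff (fun x hx => by
    have : x < -t := hx
    exact (by linarith : x ≤ t)) measurableSet_Iio, hsymIio, hIoi, hFt]
  ring

lemma chiSq_prob (d : ℕ) (hd : 1 ≤ d) : IsProbabilityMeasure (chiSq d) := by
  have : (0:ℝ) < d := by exact_mod_cast hd
  exact isProbabilityMeasure_gammaMeasure (by positivity) (by norm_num)

lemma chiSq_pos (d : ℕ) : ∀ᵐ q ∂(chiSq d), 0 < q := by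
  have h : (chiSq d) (Set.Iic 0) = 0 := by
    rw [chiSq, gammaMeasure, withDensity_apply _ measurableSet_Iic,
      ← setLIntegral_congr (Iio_ae_eq_Iic), lintegral_gammaPDF_of_nonpos le_rfl]
  rw [ae_iff]
  convert h using 2
  ext x
  simp

lemma studentT_prob (d : ℕ) (hd : 1 ≤ d) : IsProbabilityMeasure (studentT d) := by
  have := chiSq_prob d hd
  exact Measure.isProbabilityMeasure_map (by fun_prop)

lemma studentT_atom (d : ℕ) (hd : 1 ≤ d) (x : ℝ) : studentT d {x} = 0 := by
  have := chiSq_prob d hd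
  have hd0 : (0:ℝ) < d := by exact_mod_cast hd
  have hm : Measurable (fun p : ℝ × ℝ => p.1 / Real.sqrt (p.2 / d)) := by fun_prop
  rw [studentT, Measure.map_apply hm (measurableSet_singleton x),
    Measure.prod_apply_symm (hm (measurableSet_singleton x))]
  rw [lintegral_eq_zero_iff' (Measurable.aemeasurable
    (measurable_measure_prodMk_right (hm (measurableSet_singleton x))))]
  filter_upwards [chiSq_pos d] with q hq
  have hsq : 0 < Real.sqrt (q / d) := Real.sqrt_pos.2 (by positivity)
  have hna : NullSingletonClass (gaussianReal 0 1) := nullSingletonClass_gaussianReal (by norm_num)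
  refine measure_mono_null (t := {x * Real.sqrt (q / d)}) ?_ (measure_singleton _)
  intro z hz
  have hz : z / Real.sqrt (q / d) = x := hz
  simp only [Set.mem_singleton_iff]
  rw [← hz]; field_simp

lemma studentT_symm (d : ℕ) (hd : 1 ≤ d) : (studentT d).map (fun x => -x) = studentT d := by
  have := chiSq_prob d hd
  have hm : Measurable (fun p : ℝ × ℝ => p.1 / Real.sqrt (p.2 / d)) := by fun_prop
  rw [studentT, Measure.map_map (by fun_prop) hm]
  have e : ((fun x : ℝ => -x) ∘ fun p : ℝ × ℝ => p.1 / Real.sqrt (p.2 / d)) =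
      (fun p : ℝ × ℝ => p.1 / Real.sqrt (p.2 / d)) ∘ (Prod.map (fun x => -x) id) := by
    ext p; simp [neg_div]
  rw [e, ← Measure.map_map hm (by fun_prop), ← Measure.map_prod_map _ _ (by fun_prop) measurable_id,
    Measure.map_id, gaussianReal_map_neg, neg_zero]

lemma tQuantile_spec (d : ℕ) (hd : 1 ≤ d) (α : ℝ) (hα : α ∈ Set.Ioo (0:ℝ) 1) :
    0 < tQuantile d (1 - α / 2) ∧
      (studentT d).real (Set.Icc (-tQuantile d (1 - α / 2)) (tQuantile d (1 - α / 2))) = 1 - α := by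
  have := studentT_prob d hd
  have h := quantile_symm (studentT d) (studentT_atom d hd) (studentT_symm d hd) (1 - α / 2)
    (by linarith [hα.2]) (by linarith [hα.1]) (tQuantile d (1 - α / 2)) rfl
  refine ⟨h.1, ?_⟩
  rw [h.2]; ring

lemma cone_iff {a N d t : ℝ} (hN : 0 ≤ N) (hd : 0 < d) (ht : 0 < t) (hR : 0 < N ^ 2 - a ^ 2) :
    |a / Real.sqrt ((N ^ 2 - a ^ 2) / d)| ≤ t ↔ |a| ≤ t / Real.sqrt (d + t ^ 2) * N := by
  have h1 : 0 < Real.sqrt ((N ^ 2 - a ^ 2) / d) := Real.sqrt_pos.2 (by positivity)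
  have h2 : 0 < Real.sqrt (d + t ^ 2) := Real.sqrt_pos.2 (by positivity)
  rw [abs_div, abs_of_pos h1, div_le_iff₀ h1, div_mul_eq_mul_div, le_div_iff₀ h2,
    ← sq_le_sq₀ (abs_nonneg a) (by positivity),
    ← sq_le_sq₀ (a := |a| * Real.sqrt (d + t ^ 2)) (by positivity) (by positivity),
    mul_pow, mul_pow, mul_pow, Real.sq_sqrt (by positivity), Real.sq_sqrt (by positivity), sq_abs,
    mul_div_assoc', le_div_iff₀ hd]
  constructor <;> intro h <;> nlinarith

variable {E : Type*} [NormedAddCommGroup E] [InnerProductSpace ℝ E] [FiniteDimensional ℝ E]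
  [MeasurableSpace E] [BorelSpace E]

lemma tcone_prob (d : ℕ) (hd : 1 ≤ d) (hf : Module.finrank ℝ E = d + 1) (u : E) (hu : u ≠ 0)
    (α : ℝ) (hα : α ∈ Set.Ioo (0:ℝ) 1) :
    (stdGaussian E).real (tcone u (tQuantile d (1 - α / 2) * ‖u‖ /
      Real.sqrt (d + tQuantile d (1 - α / 2) ^ 2))) = 1 - α := by
  obtain ⟨htpos, ht⟩ := tQuantile_spec d hd α hα
  set t := tQuantile d (1 - α / 2) with htdef
  have hd0 : (0:ℝ) < d := by exact_mod_cast hd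
  have hun : 0 < ‖u‖ := norm_pos_iff.2 hu
  set e : E := ‖u‖⁻¹ • u with he
  have he1 : ‖e‖ = 1 := by
    rw [he, norm_smul, norm_inv, norm_norm, inv_mul_cancel₀ hun.ne']
  have hin : ∀ z : E, inner ℝ u z = ‖u‖ * inner ℝ e z := by
    intro z
    rw [he, real_inner_smul_left]; field_simp
  have hJ := joint_law d hd hf e he1
  have := chiSq_prob d hd
  have hm : Measurable (fun p : ℝ × ℝ => p.1 / Real.sqrt (p.2 / d)) := by fun_prop
  have hmz : Measurable (fun z : E => (inner ℝ e z, ‖z‖ ^ 2 - (inner ℝ e z) ^ 2)) := by fun_prop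
  have hpos : ∀ᵐ z ∂(stdGaussian E), 0 < ‖z‖ ^ 2 - (inner ℝ e z) ^ 2 := by
    have h1 : ∀ᵐ p ∂((gaussianReal 0 1).prod (chiSq d)), 0 < p.2 :=
      Measure.quasiMeasurePreserving_snd.ae (chiSq_pos d)
    rw [← hJ] at h1
    exact ae_of_ae_map hmz.aemeasurable h1
  rw [← ht, studentT, map_measureReal_apply hm measurableSet_Icc, ← hJ,
    map_measureReal_apply hmz (hm measurableSet_Icc)]
  refine measureReal_congr ?_
  filter_upwards [hpos] with z hz
  refine propext ?_
  change |inner ℝ u z| ≤ _ * ‖z‖ ↔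
    inner ℝ e z / Real.sqrt ((‖z‖ ^ 2 - (inner ℝ e z) ^ 2) / d) ∈ Set.Icc (-t) t
  rw [Set.mem_Icc, ← abs_le, cone_iff (norm_nonneg z) hd0 htpos hz, hin, abs_mul, abs_of_pos hun]
  have : t * ‖u‖ / Real.sqrt (d + t ^ 2) * ‖z‖ = ‖u‖ * (t / Real.sqrt (d + t ^ 2) * ‖z‖) := by ring
  rw [this, mul_le_mul_iff_right₀ hun]

end Quantile

section LimitPart
set_option linter.unusedSectionVars false

lemma gauss_lim {K : ℕ} (s : ℝ) (hs : 0 < s) (μ : Measure (Fin K → ℝ))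
    (h : IsGaussianVec μ 0 (s ^ 2 • (1 : Matrix (Fin K) (Fin K) ℝ))) :
    μ = (stdGaussian (EuclideanSpace ℝ (Fin K))).map (fun z => s • WithLp.ofLp z) := by
  obtain ⟨A, hA, hμ⟩ := h
  set B : Matrix (Fin K) (Fin K) ℝ := s⁻¹ • A with hB
  have hBB : B * Bᵀ = 1 := by
    rw [hB, transpose_smul, smul_mul_smul_comm, ← hA, smul_smul]
    have : s⁻¹ * s⁻¹ * s ^ 2 = 1 := by field_simp
    rw [this, one_smul]
  have hBB' : Bᵀ * B = 1 := mul_eq_one_comm.1 hBB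
  have hnorm : ∀ z : EuclideanSpace ℝ (Fin K), ‖Matrix.toEuclideanLin B z‖ = ‖z‖ := by
    intro z
    rw [← sq_eq_sq₀ (norm_nonneg _) (norm_nonneg _), EuclideanSpace.real_norm_sq_eq,
      EuclideanSpace.real_norm_sq_eq]
    have h1 : ∑ i, (Matrix.toEuclideanLin B z) i ^ 2 = (B *ᵥ z.ofLp) ⬝ᵥ (B *ᵥ z.ofLp) := by
      simp [dotProduct, sq, Matrix.toLpLin_apply]
    rw [h1, dotProduct_mulVec, ← mulVec_transpose, mulVec_mulVec, hBB', one_mulVec]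
    simp [dotProduct, sq]
  let I : EuclideanSpace ℝ (Fin K) →ₗᵢ[ℝ] EuclideanSpace ℝ (Fin K) := ⟨Matrix.toEuclideanLin B, hnorm⟩
  let J := I.toLinearIsometryEquiv rfl
  have hJ := stdGaussian_map J
  have hJc : ∀ z, J z = WithLp.toLp 2 (B *ᵥ z.ofLp) := by
    intro z
    change Matrix.toEuclideanLin B z = _
    simp [Matrix.toLpLin_apply]
  rw [← hJ, Measure.map_map (by fun_prop) (by fun_prop), ← map_pi_eq_stdGaussian,
    Measure.map_map (by fun_prop) (by fun_prop), hμ]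
  congr 1
  ext x i
  simp only [zero_add, Function.comp_apply, hJc, hB, smul_mulVec, Pi.smul_apply, smul_eq_mul]
  field_simp

lemma level_null {E : Type*} [NormedAddCommGroup E] [InnerProductSpace ℝ E] [FiniteDimensional ℝ E]
    [MeasurableSpace E] [BorelSpace E] (u : E) (f : E → ℝ) (hf : Measurable f)
    (hadd : ∀ c : ℝ, ∀ z, f (z + c • u) = f z + c) (a : ℝ) :
    (stdGaussian E) {z | f z = a} = 0 := by
  have hm : ∀ b : ℝ, MeasurableSet {z | f z = b} := fun b => hf (measurableSet_singleton b)
  have heq : ∀ b : ℝ, (volume : Measure E) {z | f z = b} = volume {z | f z = a} := by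
    intro b
    rw [← measure_preimage_add_right volume ((b - a) • u) {z | f z = b}]
    congr 1
    ext z
    simp only [Set.mem_preimage, Set.mem_ofPred_eq, hadd]
    constructor <;> intro h <;> linarith
  have hc := Measure.countable_meas_pos_of_disjoint_iUnion (μ := (volume : Measure E)) (ι := ℝ)
    (As := fun b => {z | f z = b}) hm (by
      intro b b' hbb'
      rw [Function.onFun, Set.disjoint_left]
      intro z hz hz'
      exact hbb' ((show f z = b from hz).symm.trans hz'))
  have h0 : (volume : Measure E) {z | f z = a} = 0 := by
    by_contra hne
    have : {i : ℝ | 0 < (volume : Measure E) {z | f z = i}} = Set.univ := by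
      ext b
      simp only [Set.mem_ofPred_eq, Set.mem_univ, iff_true, heq b]
      exact pos_iff_ne_zero.2 hne
    rw [this] at hc
    exact Cardinal.not_countable_real hc
  rw [stdGaussian_eq]
  exact withDensity_absolutelyContinuous _ _ h0

lemma cov_event {K : ℕ} {L U : (Fin K → ℝ) → ℝ} (hH : Homogeneous L U) (y : Fin K → ℝ) (ψ δ r : ℝ)
    (hr : 0 < r) :
    (L y ≤ ψ + δ / r ∧ ψ + δ / r ≤ U y) ↔
      (L (r • (y - ψ • 1)) ≤ δ ∧ δ ≤ U (r • (y - ψ • 1))) := by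
  obtain ⟨h1, h2, -, -⟩ := hH
  have e : y - ψ • (1 : Fin K → ℝ) = y + (-ψ) • 1 := by rw [neg_smul, sub_eq_add_neg]
  rw [(h1 r hr _).1, (h1 r hr _).2, e, (h2 _ _).1, (h2 _ _).2]
  have hd : δ = r * (δ / r) := by field_simp
  constructor
  · rintro ⟨h3, h4⟩
    constructor
    · rw [hd]; exact mul_le_mul_of_nonneg_left (by linarith) hr.le
    · nth_rw 1 [hd]; exact mul_le_mul_of_nonneg_left (by linarith) hr.le
  · rintro ⟨h3, h4⟩
    rw [hd] at h3
    nth_rw 1 [hd] at h4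
    have h5 := le_of_mul_le_mul_left h3 hr
    have h6 := le_of_mul_le_mul_left h4 hr
    constructor <;> linarith

lemma cov_tendsto {Ω : Type*} [MeasurableSpace Ω] (P : Measure Ω) [IsProbabilityMeasure P]
    (K : ℕ) (ψ : ℝ)
    (Y : ℕ → Ω → Fin K → ℝ) (hYmeas : ∀ n, Measurable (Y n))
    (s : ℝ) (hs : 0 < s) (μlim : Measure (Fin K → ℝ))
    (hGauss : IsGaussianVec μlim 0 (s ^ 2 • (1 : Matrix (Fin K) (Fin K) ℝ)))
    (hCLT : TendstoInDist P (fun n ω => Real.sqrt n • (Y n ω - ψ • 1)) μlim)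
    (L U : (Fin K → ℝ) → ℝ) (hH : Homogeneous L U) (δ : ℝ) :
    Tendsto (fun n : ℕ => (P {ω | L (Y n ω) ≤ ψ + δ / Real.sqrt n ∧
          ψ + δ / Real.sqrt n ≤ U (Y n ω)}).toReal) atTop
      (𝓝 (gcov (WithLp.toLp 2 (1 : Fin K → ℝ))
        {z : EuclideanSpace ℝ (Fin K) | L z.ofLp ≤ 0 ∧ 0 ≤ U z.ofLp} (δ / s))) := by
  have hμ := gauss_lim s hs μlim hGauss
  have hsm : Measurable (fun z : EuclideanSpace ℝ (Fin K) => s • WithLp.ofLp z) := by fun_prop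
  have hprob : IsProbabilityMeasure μlim := by
    rw [hμ]; exact Measure.isProbabilityMeasure_map (by fun_prop)
  have hZ : ∀ n : ℕ, Measurable (fun ω => Real.sqrt n • (Y n ω - ψ • (1 : Fin K → ℝ))) := by
    intro n
    have := hYmeas n
    fun_prop
  obtain ⟨h1, h2, hLc, hUc⟩ := hH
  let ν : ℕ → ProbabilityMeasure (Fin K → ℝ) := fun n =>
    ⟨P.map (fun ω => Real.sqrt n • (Y n ω - ψ • (1 : Fin K → ℝ))),
      Measure.isProbabilityMeasure_map (hZ n).aemeasurable⟩
  let νl : ProbabilityMeasure (Fin K → ℝ) := ⟨μlim, hprob⟩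
  have hconv : Tendsto ν atTop (𝓝 νl) := by
    rw [ProbabilityMeasure.tendsto_iff_forall_integral_tendsto]
    intro f
    have := hCLT f
    refine this.congr fun n => Eq.symm ?_
    change ∫ x, f x ∂(P.map _) = _
    rw [integral_map (hZ n).aemeasurable (by fun_prop)]
  let D : Set (Fin K → ℝ) := {x | L x ≤ δ ∧ δ ≤ U x}
  have hDm : MeasurableSet D :=
    (measurableSet_le hLc.measurable measurable_const).inter
      (measurableSet_le measurable_const hUc.measurable)
  have hlevel : ∀ f : (Fin K → ℝ) → ℝ, Continuous f → (∀ c : ℝ, 0 < c → ∀ x, f (c • x) = c * f x) →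
      (∀ c : ℝ, ∀ x, f (x + c • 1) = f x + c) → μlim {x | f x = δ} = 0 := by
    intro f hf hf1 hf2
    have hset : {x | f x = δ} = f ⁻¹' {δ} := rfl
    rw [hset, hμ, Measure.map_apply hsm (hf.measurable (measurableSet_singleton δ))]
    have := level_null (WithLp.toLp 2 (1 : Fin K → ℝ)) (fun z : EuclideanSpace ℝ (Fin K) => f z.ofLp)
      (by have := hf.measurable; fun_prop) (fun c z => by simp [hf2]) (δ / s)
    convert this using 2
    ext z
    simp only [Set.mem_preimage, Set.mem_singleton_iff, Set.mem_ofPred_eq, hf1 s hs]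
    rw [eq_div_iff hs.ne', mul_comm]
  have hfr : frontier D ⊆ {x | L x = δ} ∪ {x | U x = δ} := by
    have e : D = {x | L x ≤ δ} ∩ {x | δ ≤ U x} := rfl
    rw [e]
    refine (frontier_inter_subset _ _).trans ?_
    rintro x (⟨hx, -⟩ | ⟨-, hx⟩)
    · exact Or.inl (frontier_le_subset_eq hLc continuous_const hx)
    · exact Or.inr (frontier_le_subset_eq continuous_const hUc hx).symm
  have hnull : (νl : Measure (Fin K → ℝ)) (frontier D) = 0 := by
    refine measure_mono_null hfr (measure_union_null ?_ ?_)
    · exact hlevel L hLc (fun c hc x => (h1 c hc x).1) (fun c x => (h2 c x).1)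
    · exact hlevel U hUc (fun c hc x => (h1 c hc x).2) (fun c x => (h2 c x).2)
  have hfin := ProbabilityMeasure.tendsto_measure_of_null_frontier_of_tendsto' hconv hnull
  have hfin' := (ENNReal.tendsto_toReal (measure_ne_top _ _)).comp hfin
  have hlim : ((νl : Measure (Fin K → ℝ)) D).toReal = gcov (WithLp.toLp 2 (1 : Fin K → ℝ))
        {z : EuclideanSpace ℝ (Fin K) | L z.ofLp ≤ 0 ∧ 0 ≤ U z.ofLp} (δ / s) := by
    change (μlim D).toReal = _
    rw [hμ, Measure.map_apply hsm hDm, gcov, measureReal_def]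
    congr 2
    ext z
    have e : (z - (δ / s) • WithLp.toLp 2 (1 : Fin K → ℝ)).ofLp = z.ofLp + (-(δ / s)) • 1 := by
      rw [neg_smul, ← sub_eq_add_neg]; rfl
    simp only [Set.mem_preimage, Set.mem_ofPred_eq, D, e]
    rw [(h1 s hs _).1, (h1 s hs _).2, (h2 _ _).1, (h2 _ _).2, ← le_div_iff₀' hs, ← div_le_iff₀' hs]
    constructor <;> rintro ⟨h3, h4⟩ <;> constructor <;> linarith
  rw [hlim] at hfin'
  refine hfin'.congr' ?_
  filter_upwards [eventually_ge_atTop 1] with n hn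
  have hr : 0 < Real.sqrt n := Real.sqrt_pos.2 (by exact_mod_cast hn)
  change (P.map _ D).toReal = _
  rw [Measure.map_apply (hZ n) hDm]
  congr 2
  ext ω
  exact (cov_event ⟨h1, h2, hLc, hUc⟩ (Y n ω) ψ δ _ hr).symm

end LimitPart

lemma batch_homogeneous (d : ℕ) (t : ℝ) (LB UB : (Fin (d + 1) → ℝ) → ℝ)
    (hLB : ∀ y, LB y = (∑ j, y j) / ((d + 1 : ℕ) : ℝ) -
      t * Real.sqrt ((∑ j, (y j - (∑ i, y i) / ((d + 1 : ℕ) : ℝ)) ^ 2) / (d : ℝ)) /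
        Real.sqrt ((d + 1 : ℕ) : ℝ))
    (hUB : ∀ y, UB y = (∑ j, y j) / ((d + 1 : ℕ) : ℝ) +
      t * Real.sqrt ((∑ j, (y j - (∑ i, y i) / ((d + 1 : ℕ) : ℝ)) ^ 2) / (d : ℝ)) /
        Real.sqrt ((d + 1 : ℕ) : ℝ)) : Homogeneous LB UB := by
  have hK : (((d + 1 : ℕ) : ℝ)) ≠ 0 := by positivity
  have hms : ∀ (c : ℝ) (x : Fin (d + 1) → ℝ), (∑ j, (c • x) j) / ((d + 1 : ℕ) : ℝ) =
      c * ((∑ j, x j) / ((d + 1 : ℕ) : ℝ)) := by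
    intro c x
    simp only [Pi.smul_apply, smul_eq_mul, ← Finset.mul_sum]; ring
  have hma : ∀ (c : ℝ) (x : Fin (d + 1) → ℝ), (∑ j, (x + c • (1 : Fin (d + 1) → ℝ)) j) /
      ((d + 1 : ℕ) : ℝ) = (∑ j, x j) / ((d + 1 : ℕ) : ℝ) + c := by
    intro c x
    simp only [Pi.add_apply, Pi.smul_apply, Pi.one_apply, smul_eq_mul, mul_one,
      Finset.sum_add_distrib, Finset.sum_const, Finset.card_univ, Fintype.card_fin, nsmul_eq_mul]
    field_simp
  have hvs : ∀ (c : ℝ), 0 < c → ∀ (x : Fin (d + 1) → ℝ),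
      Real.sqrt ((∑ j, ((c • x) j - (∑ i, (c • x) i) / ((d + 1 : ℕ) : ℝ)) ^ 2) / (d : ℝ)) =
      c * Real.sqrt ((∑ j, (x j - (∑ i, x i) / ((d + 1 : ℕ) : ℝ)) ^ 2) / (d : ℝ)) := by
    intro c hc x
    rw [hms]
    have : (∑ j, ((c • x) j - c * ((∑ i, x i) / ((d + 1 : ℕ) : ℝ))) ^ 2) / (d : ℝ) =
        c ^ 2 * ((∑ j, (x j - (∑ i, x i) / ((d + 1 : ℕ) : ℝ)) ^ 2) / (d : ℝ)) := by
      simp only [Pi.smul_apply, smul_eq_mul, ← mul_sub, mul_pow, ← Finset.mul_sum]; ring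
    rw [this, Real.sqrt_mul (by positivity), Real.sqrt_sq hc.le]
  have hva : ∀ (c : ℝ) (x : Fin (d + 1) → ℝ),
      (∑ j, ((x + c • (1 : Fin (d + 1) → ℝ)) j -
        (∑ i, (x + c • (1 : Fin (d + 1) → ℝ)) i) / ((d + 1 : ℕ) : ℝ)) ^ 2) =
      (∑ j, (x j - (∑ i, x i) / ((d + 1 : ℕ) : ℝ)) ^ 2) := by
    intro c x
    rw [hma]
    refine Finset.sum_congr rfl fun j _ => ?_
    simp
  refine ⟨fun c hc x => ⟨?_, ?_⟩, fun c x => ⟨?_, ?_⟩, ?_, ?_⟩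
  · rw [hLB, hLB, hvs c hc, hms]; ring
  · rw [hUB, hUB, hvs c hc, hms]; ring
  · rw [hLB, hLB, hva, hma]; ring
  · rw [hUB, hUB, hva, hma]; ring
  · rw [funext hLB]; fun_prop
  · rw [funext hUB]; fun_prop

lemma batch_cone (d : ℕ) (hd : 1 ≤ d) (t : ℝ) (ht : 0 < t) (LB UB : (Fin (d + 1) → ℝ) → ℝ)
    (hLB : ∀ y, LB y = (∑ j, y j) / ((d + 1 : ℕ) : ℝ) -
      t * Real.sqrt ((∑ j, (y j - (∑ i, y i) / ((d + 1 : ℕ) : ℝ)) ^ 2) / (d : ℝ)) /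
        Real.sqrt ((d + 1 : ℕ) : ℝ))
    (hUB : ∀ y, UB y = (∑ j, y j) / ((d + 1 : ℕ) : ℝ) +
      t * Real.sqrt ((∑ j, (y j - (∑ i, y i) / ((d + 1 : ℕ) : ℝ)) ^ 2) / (d : ℝ)) /
        Real.sqrt ((d + 1 : ℕ) : ℝ)) :
    {z : EuclideanSpace ℝ (Fin (d + 1)) | LB z.ofLp ≤ 0 ∧ 0 ≤ UB z.ofLp} =
      tcone (WithLp.toLp 2 (1 : Fin (d + 1) → ℝ))
        (t * ‖WithLp.toLp 2 (1 : Fin (d + 1) → ℝ)‖ / Real.sqrt (d + t ^ 2)) := by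
  have hd0 : (0:ℝ) < d := by exact_mod_cast hd
  ext z
  have hin : inner ℝ (WithLp.toLp 2 (1 : Fin (d + 1) → ℝ)) z = ∑ j, z j := by
    simp [PiLp.inner_apply]
  have hnu : ‖WithLp.toLp 2 (1 : Fin (d + 1) → ℝ)‖ = Real.sqrt ((d + 1 : ℕ) : ℝ) := by
    simp [EuclideanSpace.norm_eq]
  have hnz : ‖z‖ ^ 2 = ∑ j, z j ^ 2 := EuclideanSpace.real_norm_sq_eq z
  set k : ℝ := ((d + 1 : ℕ) : ℝ) with hk
  have hk0 : 0 < k := by rw [hk]; positivity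
  set S : ℝ := ∑ j, z j with hS
  have hV : ∑ j, (z j - S / k) ^ 2 = ‖z‖ ^ 2 - S ^ 2 / k := by
    rw [hnz]
    have : ∀ j, (z j - S / k) ^ 2 = z j ^ 2 - 2 * (S / k) * z j + (S / k) ^ 2 := fun j => by ring
    simp_rw [this]
    rw [Finset.sum_add_distrib, Finset.sum_sub_distrib, ← Finset.mul_sum, ← hS]
    simp only [Finset.sum_const, Finset.card_univ, Fintype.card_fin, nsmul_eq_mul, ← hk]
    field_simp; ring
  have hVn : 0 ≤ ‖z‖ ^ 2 - S ^ 2 / k := by rw [← hV]; positivity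
  change LB z.ofLp ≤ 0 ∧ 0 ≤ UB z.ofLp ↔ |inner ℝ _ z| ≤ _ * ‖z‖
  rw [hLB, hUB, hin, hnu, hV, sub_nonpos, ← neg_le_iff_add_nonneg, and_comm, ← abs_le]
  have h2 : 0 < Real.sqrt (d + t ^ 2) := Real.sqrt_pos.2 (by positivity)
  have h3 : 0 < Real.sqrt k := Real.sqrt_pos.2 hk0
  rw [abs_div, abs_of_pos hk0, div_le_div_iff₀ hk0 h3, div_mul_eq_mul_div, le_div_iff₀ h2,
    ← sq_le_sq₀ (by positivity) (by positivity),
    ← sq_le_sq₀ (a := |S| * Real.sqrt (d + t ^ 2)) (by positivity) (by positivity)]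
  simp only [mul_pow, sq_abs]
  rw [Real.sq_sqrt hk0.le, Real.sq_sqrt (by positivity), Real.sq_sqrt (by positivity)]
  have e : t ^ 2 * ((‖z‖ ^ 2 - S ^ 2 / k) / d) * k ^ 2 = t ^ 2 * (k * ‖z‖ ^ 2 - S ^ 2) / d * k := by
    field_simp
  rw [e, mul_le_mul_iff_left₀ hk0, le_div_iff₀ hd0]
  constructor <;> intro h <;> linarith

/-- Standard batching is asymptotically uniformly most accurate unbiased among
homogeneous confidence intervals: its coverage of local alternatives `ψ + δ/√n` converges, with
limit `1 - α` at `δ = 0` and at most `1 - α` for `δ ≠ 0`, and every homogeneous asymptotically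
unbiased interval has asymptotic coverage of each alternative at least that of batching. -/
theorem stmt1 {Ω : Type*} [MeasurableSpace Ω] (P : Measure Ω) [IsProbabilityMeasure P]
    (K : ℕ) (hK : 2 ≤ K) (α : ℝ) (hα : α ∈ Set.Ioo (0 : ℝ) 1) (ψ : ℝ)
    (Y : ℕ → Ω → Fin K → ℝ) (hYmeas : ∀ n, Measurable (Y n))
    (s : ℝ) (hs : 0 < s) (μlim : Measure (Fin K → ℝ))
    (hGauss : IsGaussianVec μlim 0 (s ^ 2 • (1 : Matrix (Fin K) (Fin K) ℝ)))
    (hCLT : TendstoInDist P (fun n ω => Real.sqrt n • (Y n ω - ψ • 1)) μlim)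
    (LB UB : (Fin K → ℝ) → ℝ)
    (hLB : ∀ y, LB y = (∑ j, y j) / K -
      tQuantile ((K : ℝ) - 1) (1 - α / 2) *
        Real.sqrt ((∑ j, (y j - (∑ i, y i) / K) ^ 2) / ((K : ℝ) - 1)) / Real.sqrt K)
    (hUB : ∀ y, UB y = (∑ j, y j) / K +
      tQuantile ((K : ℝ) - 1) (1 - α / 2) *
        Real.sqrt ((∑ j, (y j - (∑ i, y i) / K) ^ 2) / ((K : ℝ) - 1)) / Real.sqrt K) :
    ∃ ℓ : ℝ → ℝ,
      -- (i) the coverage of every local alternative under standard batching converges,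
      (∀ δ : ℝ, Tendsto (fun n => (P {ω | LB (Y n ω) ≤ ψ + δ / Real.sqrt n ∧
          ψ + δ / Real.sqrt n ≤ UB (Y n ω)}).toReal) atTop (𝓝 (ℓ δ))) ∧
      ℓ 0 = 1 - α ∧ (∀ δ : ℝ, δ ≠ 0 → ℓ δ ≤ 1 - α) ∧
      -- (ii) batching is asymptotically UMA unbiased among homogeneous CIs
      (∀ L U : (Fin K → ℝ) → ℝ, Homogeneous L U → AsympUnbiased P Y ψ α L U →
        ∀ δ : ℝ, δ ≠ 0 →
          ℓ δ ≤ limsup (fun n => (P {ω | L (Y n ω) ≤ ψ + δ / Real.sqrt n ∧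
            ψ + δ / Real.sqrt n ≤ U (Y n ω)}).toReal) atTop) := by
  obtain ⟨d, rfl⟩ : ∃ d, K = d + 1 := ⟨K - 1, by omega⟩
  have hd : 1 ≤ d := by omega
  have hd0 : (0:ℝ) < d := by exact_mod_cast hd
  have hcast : (((d + 1 : ℕ) : ℝ)) - 1 = d := by push_cast; ring
  rw [hcast] at hLB hUB
  have htpos := (tQuantile_spec d hd α hα).1
  have hHB := batch_homogeneous d (tQuantile d (1 - α / 2)) LB UB hLB hUB
  have hcone := batch_cone d hd (tQuantile d (1 - α / 2)) htpos LB UB hLB hUB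
  have hune : (WithLp.toLp 2 (1 : Fin (d + 1) → ℝ)) ≠ (0 : EuclideanSpace ℝ (Fin (d + 1))) := by
    intro h
    have := congrArg (fun z : EuclideanSpace ℝ (Fin (d + 1)) => z 0) h
    simp at this
  have hprob := tcone_prob d hd (E := EuclideanSpace ℝ (Fin (d + 1))) (by simp) _ hune α hα
  have hcpos : 0 < tQuantile d (1 - α / 2) * ‖(WithLp.toLp 2 (1 : Fin (d + 1) → ℝ))‖ /
      Real.sqrt (d + tQuantile d (1 - α / 2) ^ 2) :=
    div_pos (mul_pos htpos (norm_pos_iff.2 hune)) (Real.sqrt_pos.2 (by positivity))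
  set u : EuclideanSpace ℝ (Fin (d + 1)) := WithLp.toLp 2 (1 : Fin (d + 1) → ℝ) with hu
  set c : ℝ := tQuantile d (1 - α / 2) * ‖u‖ / Real.sqrt (d + tQuantile d (1 - α / 2) ^ 2) with hc
  have h0 : gcov u (tcone u c) 0 = 1 - α := by rw [gcov_zero, hprob]
  refine ⟨fun δ => gcov u (tcone u c) (δ / s), ?_, ?_, ?_, ?_⟩
  · intro δ
    have := cov_tendsto P (d + 1) ψ Y hYmeas s hs μlim hGauss hCLT LB UB hHB δ
    rw [hcone] at this
    exact this
  · simp only [zero_div, h0]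
  · intro δ _
    have := gcov_unbiased u c hcpos (δ / s)
    rw [h0] at this
    exact this
  · intro L U hH hunb δ hδ
    have hten := cov_tendsto P (d + 1) ψ Y hYmeas s hs μlim hGauss hCLT L U hH
    rw [(hten δ).limsup_eq]
    refine gcov_compare u c hcpos _ ?_ ?_ ?_ ?_ (δ / s)
    · have h1 := hH.2.2.1.measurable
      have h2 := hH.2.2.2.measurable
      exact (measurableSet_le (by fun_prop : Measurable fun z : EuclideanSpace ℝ (Fin (d + 1)) =>
        L z.ofLp) measurable_const).inter (measurableSet_le measurable_const
          (by fun_prop : Measurable fun z : EuclideanSpace ℝ (Fin (d + 1)) => U z.ofLp))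
    · intro a ha x
      simp only [Set.mem_ofPred_eq, WithLp.ofLp_smul, (hH.1 a ha _).1, (hH.1 a ha _).2]
      rw [mul_nonneg_iff_of_pos_left ha, ← neg_nonneg, ← mul_neg, mul_nonneg_iff_of_pos_left ha,
        neg_nonneg]
    · rw [h0]
      obtain ⟨⟨l, hl, hlt⟩, -⟩ := hunb
      have h3 := hten 0
      simp only [zero_div, add_zero] at h3
      rw [← tendsto_nhds_unique hlt h3]
      exact hl
    · intro m hm
      rw [h0]
      have h3 := hunb.2 (m * s) (mul_ne_zero hm hs.ne')
      rw [(hten (m * s)).limsup_eq, mul_div_cancel_right₀ _ hs.ne'] at h3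
      exact h3
end
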